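/- arXiv:2304.08689 — 3 statements merged into one kernel-verified Lean document; each statement's English description precedes it below -/
import Mathlib

section
/- For every real ε > 0 there exists C > 0, depending only on ε, with the following property. Let p be a prime, let K be an integer, and let 𝓜 ⊆ 𝔽_p^* be a set of cardinality M, such that either (i) p > K ≥ p^{2/3} and K·M ≥ p, or (ii) K < p^{2/3}, M ≥ p^{1/3}, and K·M^{1/4} ≥ p^{3/4}. Let J(𝓚, 𝓜) denote the number of quadruples (k_1, k_2, m_1, m_2) with k_1, k_2 ∈ {1, …, K} and m_1, m_2 ∈ 𝓜 satisfying k_1·m_1 ≡ k_2·m_2 (mod p). Then J(𝓚, 𝓜) ≤ C·K^2·M^2·p^{−1+ε}. -/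
open Finset

lemma divisor_bound (d : ℝ) (hd : 0 < d) : ∃ C : ℝ, 1 ≤ C ∧ ∀ n : ℕ, 1 ≤ n →
    ((n.divisors.card : ℕ) : ℝ) ≤ C * (n : ℝ) ^ d := by
  set D : ℝ := max 1 (1 / (d * Real.log 2)) with hD
  have hl2 : 0 < Real.log 2 := Real.log_pos (by norm_num)
  have hD1 : 1 ≤ D := le_max_left _ _
  have hD2 : 1 ≤ D * (d * Real.log 2) := by
    have : 1 / (d * Real.log 2) ≤ D := le_max_right _ _
    rwa [div_le_iff₀ (by positivity)] at this
  obtain ⟨Q, hQ⟩ := exists_nat_ge ((2 : ℝ) ^ (1 / d))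
  refine ⟨D ^ Q, one_le_pow₀ hD1, fun n hn => ?_⟩
  have hn0 : n ≠ 0 := by omega
  have key : ∀ q : ℕ, q.Prime → ∀ k : ℕ,
      ((k + 1 : ℕ) : ℝ) ≤ (if q < Q then D else 1) * ((q : ℝ) ^ d) ^ k := by
    intro q hq k
    have hq2 : (2 : ℝ) ≤ q := by exact_mod_cast hq.two_le
    split_ifs with h
    · have h1 : (1 : ℝ) + k * (d * Real.log 2) ≤ ((2 : ℝ) ^ d) ^ k := by
        rw [Real.rpow_def_of_pos (by norm_num : (0:ℝ) < 2), ← Real.exp_nat_mul]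
        have := Real.add_one_le_exp ((k : ℝ) * (Real.log 2 * d))
        linarith
      have h2 : ((2 : ℝ) ^ d) ^ k ≤ ((q : ℝ) ^ d) ^ k := by gcongr
      have h3 : ((k + 1 : ℕ) : ℝ) ≤ D * (1 + k * (d * Real.log 2)) := by
        push_cast
        have : (k : ℝ) * 1 ≤ k * (D * (d * Real.log 2)) := by gcongr
        nlinarith
      calc _ ≤ _ := h3
        _ ≤ _ := by gcongr; exact h1.trans h2
    · have h1 : (2 : ℝ) ≤ (q : ℝ) ^ d := by
        have : (2 : ℝ) ^ (1 / d) ≤ q := hQ.trans (by exact_mod_cast not_lt.mp h)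
        calc (2 : ℝ) = ((2 : ℝ) ^ (1 / d)) ^ d := by
              rw [← Real.rpow_mul (by norm_num)]; field_simp; simp
          _ ≤ _ := by gcongr
      have h2 : ((k + 1 : ℕ) : ℝ) ≤ 2 ^ k := by
        exact_mod_cast Nat.succ_le_of_lt (Nat.lt_two_pow_self)
      rw [one_mul]
      exact h2.trans (by gcongr)
  rw [Nat.card_divisors hn0]
  have h4 : ((n : ℝ)) ^ d = ∏ q ∈ n.primeFactors, ((q : ℝ) ^ d) ^ (n.factorization q) := by
    conv_lhs => rw [← Nat.prod_factorization_pow_eq_self hn0]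
    rw [Finsupp.prod, Nat.support_factorization, Nat.cast_prod,
      ← Real.finsetProd_rpow _ _ (fun i _ => by positivity)]
    refine Finset.prod_congr rfl fun q _ => ?_
    push_cast
    rw [← Real.rpow_natCast, ← Real.rpow_natCast, ← Real.rpow_mul (by positivity),
      ← Real.rpow_mul (by positivity), mul_comm]
  rw [h4, Nat.cast_prod]
  calc _ ≤ ∏ q ∈ n.primeFactors, ((if q < Q then D else 1) * ((q : ℝ) ^ d) ^ (n.factorization q)) := by
        refine Finset.prod_le_prod (fun _ _ => by positivity) fun q hq => ?_
        exact key q (Nat.prime_of_mem_primeFactors hq) _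
    _ = (∏ q ∈ n.primeFactors, (if q < Q then D else 1)) * _ := Finset.prod_mul_distrib
    _ ≤ _ := by
        gcongr
        rw [Finset.prod_ite, Finset.prod_const, Finset.prod_const_one, mul_one]
        apply pow_le_pow_right₀ hD1
        calc _ ≤ (Finset.range Q).card := Finset.card_le_card (fun x hx => by
              simp at hx ⊢; exact hx.2)
          _ = Q := by simp

lemma count_aux (p s R : ℕ) (hp : 0 < p) (a b : ℤ) (hs : 0 < s) (ha : |a| = s) (hb : |b| ≤ s)
    (W : Finset (ℤ × ℤ)) (hbox : ∀ w ∈ W, |w.1| ≤ R ∧ |w.2| ≤ R)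
    (hdet : ∀ w ∈ W, (p : ℤ) ∣ a * w.2 - b * w.1)
    (hmin : ∀ w ∈ W, ∀ w' ∈ W, |w.1 - w'.1| < s → |w.2 - w'.2| < s → w = w')
    (hsR : s ≤ R) : (W.card : ℝ) ≤ 16 * (R : ℝ) ^ 2 / p + 4 * R / s := by
  set D : ℕ := 2 * s * R / p with hD
  set E : ℕ := R / s with hE
  have hpz : (0 : ℤ) < p := by exact_mod_cast hp
  have hsz : (0 : ℤ) < s := by exact_mod_cast hs
  have hcard : W.card ≤ (Finset.Icc (-(D : ℤ)) D ×ˢ Finset.Icc (-(E : ℤ) - 1) E).card := by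
    refine Finset.card_le_card_of_injOn
      (fun w => ((a * w.2 - b * w.1) / (p : ℤ), w.1 / (s : ℤ))) ?_ ?_
    · intro w hw
      obtain ⟨h1, h2⟩ := hbox w hw
      obtain ⟨t, ht⟩ := hdet w hw
      have hE1 : (R : ℤ) / s = E := by simp [hE]
      have hD1 : (2 * s * R : ℤ) / p = D := by simp [hD]
      have hdb : |(p : ℤ) * t| ≤ 2 * s * R := by
        rw [← ht]
        calc |a * w.2 - b * w.1| ≤ |a * w.2| + |b * w.1| := abs_sub _ _
          _ = |a| * |w.2| + |b| * |w.1| := by rw [abs_mul, abs_mul]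
          _ ≤ s * R + s * R := by rw [ha]; gcongr
          _ = _ := by ring
      rw [abs_mul, abs_of_pos hpz] at hdb
      have htD : |t| ≤ D := by
        rw [← hD1, Int.le_ediv_iff_mul_le hpz]; linarith
      have hx1 : w.1 / (s : ℤ) ≤ E := by
        rw [← hE1]; exact Int.ediv_le_ediv hsz (abs_le.mp h1).2
      have hx2 : -(E : ℤ) - 1 ≤ w.1 / (s : ℤ) := by
        rw [Int.le_ediv_iff_mul_le hsz]
        have : (R : ℤ) < (E + 1) * s := by
          rw [← hE1]; exact Int.lt_ediv_add_one_mul_self _ hsz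
        have := (abs_le.mp h1).1
        nlinarith
      simp only [Finset.coe_product, Set.mem_prod, Finset.coe_Icc, Set.mem_Icc]
      rw [ht, Int.mul_ediv_cancel_left _ hpz.ne']
      exact ⟨abs_le.mp htD, hx2, hx1⟩
    · intro w hw w' hw' heq
      simp only [Prod.mk.injEq] at heq
      obtain ⟨e1, e2⟩ := heq
      obtain ⟨t, ht⟩ := hdet w hw
      obtain ⟨t', ht'⟩ := hdet w' hw'
      rw [ht, ht', Int.mul_ediv_cancel_left _ hpz.ne', Int.mul_ediv_cancel_left _ hpz.ne'] at e1
      subst e1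
      have hdx : |w.1 - w'.1| < s := by
        have q1 := Int.mul_ediv_add_emod w.1 s
        have q2 := Int.mul_ediv_add_emod w'.1 s
        have r1 := Int.emod_nonneg w.1 hsz.ne'
        have r2 := Int.emod_nonneg w'.1 hsz.ne'
        have r3 := Int.emod_lt_of_pos w.1 hsz
        have r4 := Int.emod_lt_of_pos w'.1 hsz
        rw [e2] at q1
        rw [abs_lt]; constructor <;> linarith
      have hrel : a * (w.2 - w'.2) = b * (w.1 - w'.1) := by linarith
      have hdy : |w.2 - w'.2| < s := by
        have := congrArg abs hrel
        rw [abs_mul, abs_mul, ha] at this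
        have h3 : |b| * |w.1 - w'.1| ≤ s * |w.1 - w'.1| := by gcongr
        rw [← this] at h3
        exact lt_of_le_of_lt (le_of_mul_le_mul_left h3 hsz) hdx
      exact hmin w hw w' hw' hdx hdy
  have hc2 : (Finset.Icc (-(D : ℤ)) D ×ˢ Finset.Icc (-(E : ℤ) - 1) E).card
      = (2 * D + 1) * (2 * E + 2) := by
    rw [Finset.card_product, Int.card_Icc, Int.card_Icc]
    congr 1 <;> omega
  rw [hc2] at hcard
  have hpr : (0 : ℝ) < p := by exact_mod_cast hp
  have hsr : (0 : ℝ) < s := by exact_mod_cast hs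
  have hDr : (D : ℝ) ≤ 2 * s * R / p := by
    have := @Nat.cast_div_le ℝ _ _ _ (2 * s * R) p
    push_cast at this; exact this
  have hEr : (E : ℝ) ≤ R / s := Nat.cast_div_le
  have h1 : (1 : ℝ) ≤ R / s := by
    rw [le_div_iff₀ hsr, one_mul]; exact_mod_cast hsR
  calc (W.card : ℝ) ≤ (2 * D + 1) * (2 * E + 2) := by exact_mod_cast hcard
    _ ≤ (2 * (2 * s * R / p) + 1) * (2 * (R / s) + 2 * (R / s)) := by gcongr; linarith
    _ = _ := by field_simp; ring

/-- Lattice points in a box -/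
noncomputable def latBox (p R : ℕ) (l : ZMod p) : Finset (ℤ × ℤ) :=
  (Finset.Icc (-(R : ℤ)) R ×ˢ Finset.Icc (-(R : ℤ)) R).filter
    (fun w => w ≠ 0 ∧ (w.1 : ZMod p) = l * (w.2 : ZMod p))

lemma mem_latBox {p R : ℕ} {l : ZMod p} {w : ℤ × ℤ} : w ∈ latBox p R l ↔
    (|w.1| ≤ R ∧ |w.2| ≤ R) ∧ w ≠ 0 ∧ (w.1 : ZMod p) = l * (w.2 : ZMod p) := by
  simp only [latBox, Finset.mem_filter, Finset.mem_product, Finset.mem_Icc, abs_le]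

lemma exists_short (p : ℕ) [Fact p.Prime] (l : ZMod p) (hl : l ≠ 0) :
    ∃ (a b : ℤ) (s : ℕ), 0 < s ∧ s < p ∧ |a| ≤ s ∧ |b| ≤ s ∧
      (a : ZMod p) ≠ 0 ∧ (b : ZMod p) ≠ 0 ∧ (a : ZMod p) = l * (b : ZMod p) ∧
      ∀ R : ℕ, ((latBox p R l).card : ℝ) ≤ 16 * (R : ℝ) ^ 2 / p + 4 * R / s := by
  classical
  have hp : p.Prime := Fact.out
  have hex : ∃ s : ℕ, (latBox p s l).Nonempty := by
    refine ⟨p - 1, ((l.val : ℤ), 1), mem_latBox.mpr ⟨⟨?_, ?_⟩, ?_, ?_⟩⟩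
    · have := ZMod.val_lt l
      simp only [Nat.abs_cast]; omega
    · have := hp.two_le
      simp; omega
    · simp [Prod.ext_iff]
    · simp
  set s := Nat.find hex with hs
  obtain ⟨⟨a, b⟩, hab⟩ := Nat.find_spec hex
  have hmin : ∀ t, t < s → ¬ (latBox p t l).Nonempty := fun t ht => Nat.find_min hex ht
  have hsp : s < p := by
    have : s ≤ p - 1 := by
      apply Nat.find_min' hex
      refine ⟨((l.val : ℤ), 1), mem_latBox.mpr ⟨⟨?_, ?_⟩, ?_, ?_⟩⟩
      · have := ZMod.val_lt l
        simp only [Nat.abs_cast]; omega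
      · have := hp.two_le
        simp; omega
      · simp [Prod.ext_iff]
      · simp
    have := hp.two_le
    omega
  rw [← hs, mem_latBox] at hab
  obtain ⟨⟨ha, hb⟩, hne, hrel⟩ := hab
  simp only at ha hb hrel
  have hs0 : 0 < s := by
    rcases Nat.eq_zero_or_pos s with h | h
    · rw [h] at ha hb
      exfalso; apply hne
      simp at ha hb
      simp [ha, hb]
    · exact h
  have hcz : ∀ x : ℤ, |x| ≤ s → (x : ZMod p) = 0 → x = 0 := by
    intro x hx h0
    rw [ZMod.intCast_zmod_eq_zero_iff_dvd] at h0
    exact Int.eq_zero_of_abs_lt_dvd h0 (by omega)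
  have hb0 : (b : ZMod p) ≠ 0 := by
    intro h
    rw [h, mul_zero] at hrel
    exact hne (by simp [hcz a ha hrel, hcz b hb h])
  have ha0 : (a : ZMod p) ≠ 0 := by rw [hrel]; exact mul_ne_zero hl hb0
  have hmax : |a| = s ∨ |b| = s := by
    by_contra hcon
    push Not at hcon
    apply hmin (s - 1) (by omega)
    refine ⟨(a, b), mem_latBox.mpr ⟨⟨?_, ?_⟩, hne, hrel⟩⟩ <;> simp only <;> omega
  refine ⟨a, b, s, hs0, hsp, ha, hb, ha0, hb0, hrel, fun R => ?_⟩
  rcases lt_or_ge R s with hRs | hRs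
  · have : latBox p R l = ∅ := Finset.not_nonempty_iff_eq_empty.mp (hmin R hRs)
    rw [this]; simp; positivity
  have hm : ∀ w ∈ latBox p R l, ∀ w' ∈ latBox p R l,
      |w.1 - w'.1| < s → |w.2 - w'.2| < s → w = w' := by
    intro w hw w' hw' h1 h2
    by_contra hcon
    apply hmin (s - 1) (by omega)
    refine ⟨w - w', mem_latBox.mpr ⟨⟨?_, ?_⟩, sub_ne_zero.mpr hcon, ?_⟩⟩
    · simp only [Prod.fst_sub]; omega
    · simp only [Prod.snd_sub]; omega
    · simp only [Prod.fst_sub, Prod.snd_sub, Int.cast_sub]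
      rw [(mem_latBox.mp hw).2.2, (mem_latBox.mp hw').2.2, mul_sub]
  rcases hmax with h | h
  · refine count_aux p s R hp.pos a b hs0 h hb _ (fun w hw => (mem_latBox.mp hw).1) ?_ hm hRs
    intro w hw
    rw [← ZMod.intCast_zmod_eq_zero_iff_dvd]
    push_cast
    rw [(mem_latBox.mp hw).2.2, hrel]; ring
  · have hcard : (latBox p R l).card = ((latBox p R l).image Prod.swap).card :=
      (Finset.card_image_of_injective _ Prod.swap_injective).symm
    rw [hcard]
    refine count_aux p s R hp.pos b a hs0 h ha _ ?_ ?_ ?_ hRs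
    · intro w hw
      obtain ⟨z, hz, rfl⟩ := Finset.mem_image.mp hw
      exact (mem_latBox.mp hz).1.symm
    · intro w hw
      obtain ⟨z, hz, rfl⟩ := Finset.mem_image.mp hw
      rw [← ZMod.intCast_zmod_eq_zero_iff_dvd]
      simp only [Prod.fst_swap, Prod.snd_swap]
      push_cast
      rw [(mem_latBox.mp hz).2.2, hrel]; ring
    · intro w hw w' hw' h1 h2
      obtain ⟨z, hz, rfl⟩ := Finset.mem_image.mp hw
      obtain ⟨z', hz', rfl⟩ := Finset.mem_image.mp hw'
      rw [hm z hz z' hz' h2 h1]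

lemma fiber_bound (p : ℕ) [Fact p.Prime] (M : Finset (ZMod p)) (hM : ∀ m ∈ M, m ≠ 0)
    (a b : ZMod p → ℤ) (s : ZMod p → ℕ)
    (hab : ∀ l, l ≠ 0 → |a l| ≤ s l ∧ |b l| ≤ s l ∧ (a l : ZMod p) ≠ 0 ∧ (b l : ZMod p) ≠ 0 ∧
      (a l : ZMod p) = l * (b l : ZMod p)) (A T : ℕ)
    (hT : ∀ n : ℕ, 1 ≤ n → n ≤ A ^ 2 → n.divisors.card ≤ T) (m₁ m₂ : ZMod p)
    (h₁ : m₁ ≠ 0) (h₂ : m₂ ≠ 0) :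
    (M.filter (fun m => s (m₁ / m) ≤ A ∧ s (m₂ / m) ≤ A)).card ≤
      4 * T ^ 2 * (latBox p (A ^ 2) (m₁ / m₂)).card := by
  classical
  have hz : ∀ x : ℤ, (x : ZMod p) ≠ 0 → x ≠ 0 := fun x hx h => hx (by simp [h])
  refine Finset.card_le_mul_card_image_of_maps_to
    (f := fun m => (a (m₁ / m) * b (m₂ / m), b (m₁ / m) * a (m₂ / m))) ?_ _ ?_
  · intro m hm
    rw [Finset.mem_filter] at hm
    obtain ⟨hm, hs1, hs2⟩ := hm
    have hm0 := hM m hm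
    obtain ⟨q1, q2, q3, q4, q5⟩ := hab (m₁ / m) (div_ne_zero h₁ hm0)
    obtain ⟨r1, r2, r3, r4, r5⟩ := hab (m₂ / m) (div_ne_zero h₂ hm0)
    have hs1' : (s (m₁ / m) : ℤ) ≤ A := by exact_mod_cast hs1
    have hs2' : (s (m₂ / m) : ℤ) ≤ A := by exact_mod_cast hs2
    rw [mem_latBox]
    refine ⟨⟨?_, ?_⟩, ?_, ?_⟩
    · simp only [abs_mul]
      push_cast
      rw [sq]
      exact mul_le_mul (q1.trans hs1') (r2.trans hs2') (abs_nonneg _) (by positivity)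
    · simp only [abs_mul]
      push_cast
      rw [sq]
      exact mul_le_mul (q2.trans hs1') (r1.trans hs2') (abs_nonneg _) (by positivity)
    · intro h
      have := congrArg Prod.fst h
      exact mul_ne_zero (hz _ q3) (hz _ r4) this
    · simp only
      push_cast
      rw [q5, r5]
      field_simp
  · intro w hw
    rw [mem_latBox] at hw
    by_cases hemp : w.1 = 0 ∨ w.2 = 0
    · have : ∀ S : Finset (ZMod p), S = ∅ → S.card ≤ 4 * T ^ 2 := by
        rintro S rfl; simp
      apply this
      rw [Finset.filter_eq_empty_iff]
      intro m hm hw'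
      rw [Finset.mem_filter] at hm
      have hm0 := hM m hm.1
      obtain ⟨q1, q2, q3, q4, q5⟩ := hab (m₁ / m) (div_ne_zero h₁ hm0)
      obtain ⟨r1, r2, r3, r4, r5⟩ := hab (m₂ / m) (div_ne_zero h₂ hm0)
      rw [← hw'] at hemp
      rcases hemp with h | h
      · exact mul_ne_zero (hz _ q3) (hz _ r4) h
      · exact mul_ne_zero (hz _ q4) (hz _ r3) h
    push Not at hemp
    have hn : ∀ x : ℤ, x ≠ 0 → |x| ≤ ((A ^ 2 : ℕ) : ℤ) → x.natAbs.divisors.card ≤ T := by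
      intro x hx hxA
      apply hT _ (Int.natAbs_pos.mpr hx)
      rw [Int.abs_eq_natAbs] at hxA
      exact_mod_cast hxA
    calc _ ≤ ((w.1.natAbs.divisors ×ˢ w.2.natAbs.divisors) ×ˢ
          (Finset.univ : Finset (Bool × Bool))).card := by
          refine Finset.card_le_card_of_injOn (fun m => (((a (m₁ / m)).natAbs,
            (b (m₁ / m)).natAbs), (decide (a (m₁ / m) < 0), decide (b (m₁ / m) < 0)))) ?_ ?_
          · intro m hm
            simp only [Finset.coe_filter, Set.mem_ofPred_eq] at hm
            obtain ⟨hm, rfl⟩ := hm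
            simp only [Finset.coe_product, Set.mem_prod, Finset.mem_coe, Nat.mem_divisors,
              Finset.mem_univ, and_true]
            refine ⟨⟨?_, ?_⟩, ?_, ?_⟩
            · rw [Int.natAbs_dvd_natAbs]; exact dvd_mul_right _ _
            · exact Int.natAbs_ne_zero.mpr hemp.1
            · rw [Int.natAbs_dvd_natAbs]; exact dvd_mul_right _ _
            · exact Int.natAbs_ne_zero.mpr hemp.2
          · intro m hm m' hm' heq
            simp only [Finset.coe_filter, Finset.mem_filter, Set.mem_ofPred_eq] at hm hm'
            have hm0 := hM m hm.1.1
            have hm0' := hM m' hm'.1.1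
            obtain ⟨q1, q2, q3, q4, q5⟩ := hab (m₁ / m) (div_ne_zero h₁ hm0)
            obtain ⟨r1, r2, r3, r4, r5⟩ := hab (m₁ / m') (div_ne_zero h₁ hm0')
            simp only [Prod.mk.injEq, decide_eq_decide] at heq
            have ea : a (m₁ / m) = a (m₁ / m') := by omega
            have eb : b (m₁ / m) = b (m₁ / m') := by omega
            rw [ea, eb, r5] at q5
            have := mul_right_cancel₀ r4 q5
            field_simp at this
            exact this
      _ = w.1.natAbs.divisors.card * w.2.natAbs.divisors.card * 4 := by
          rw [Finset.card_product, Finset.card_product]; rfl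
      _ ≤ T * T * 4 := by
          gcongr
          · exact hn _ hemp.1 hw.1.1
          · exact hn _ hemp.2 hw.1.2
      _ = _ := by ring

lemma G_bound (p : ℕ) [Fact p.Prime] (M : Finset (ZMod p)) (hM : ∀ m ∈ M, m ≠ 0)
    (a b : ZMod p → ℤ) (s : ZMod p → ℕ)
    (hab : ∀ l, l ≠ 0 → |a l| ≤ s l ∧ |b l| ≤ s l ∧ (a l : ZMod p) ≠ 0 ∧ (b l : ZMod p) ≠ 0 ∧
      (a l : ZMod p) = l * (b l : ZMod p)) (A T : ℕ)
    (hT : ∀ n : ℕ, 1 ≤ n → n ≤ A ^ 2 → n.divisors.card ≤ T) :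
    ((M ×ˢ M).filter (fun q => s (q.1 / q.2) ≤ A)).card ^ 2 ≤
      M.card * (4 * T ^ 2 * ∑ q ∈ M ×ˢ M, (latBox p (A ^ 2) (q.1 / q.2)).card) := by
  classical
  have h1 : ((M ×ˢ M).filter (fun q => s (q.1 / q.2) ≤ A)).card =
      ∑ m ∈ M, (M.filter (fun m₁ => s (m₁ / m) ≤ A)).card := by
    simp only [Finset.card_filter]
    rw [Finset.sum_product_right]
  rw [h1]
  refine (sq_sum_le_card_mul_sum_sq).trans ?_
  refine Nat.mul_le_mul_left _ ?_
  have h2 : ∀ m ∈ M, (M.filter (fun m₁ => s (m₁ / m) ≤ A)).card ^ 2 =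
      ∑ q ∈ M ×ˢ M, if (s (q.1 / m) ≤ A ∧ s (q.2 / m) ≤ A) then 1 else 0 := by
    intro m _
    rw [sq, ← Finset.card_product, ← Finset.card_filter]
    congr 1
    ext q
    simp only [Finset.mem_product, Finset.mem_filter]
    tauto
  rw [Finset.sum_congr rfl h2, Finset.sum_comm, Finset.mul_sum]
  refine Finset.sum_le_sum fun q hq => ?_
  rw [← Finset.card_filter]
  rw [Finset.mem_product] at hq
  exact fiber_bound p M hM a b s hab A T hT q.1 q.2 (hM _ hq.1) (hM _ hq.2)

lemma J_bound (p : ℕ) [Fact p.Prime] (M : Finset (ZMod p)) (hM : ∀ m ∈ M, m ≠ 0) (K : ℕ) :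
    ((((Finset.Icc 1 K) ×ˢ (Finset.Icc 1 K)) ×ˢ (M ×ˢ M)).filter
          (fun q => (q.1.1 : ZMod p) * q.2.1 = (q.1.2 : ZMod p) * q.2.2)).card ≤
      ∑ q ∈ M ×ˢ M, (latBox p K (q.1 / q.2)).card := by
  classical
  rw [Finset.card_filter, Finset.sum_product_right]
  refine Finset.sum_le_sum fun q hq => ?_
  rw [← Finset.card_filter]
  rw [Finset.mem_product] at hq
  have h2 := hM _ hq.2
  refine Finset.card_le_card_of_injOn (fun k => ((k.2 : ℤ), (k.1 : ℤ))) ?_ ?_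
  · intro k hk
    simp only [Finset.coe_filter, Finset.mem_product, Finset.mem_Icc, Set.mem_ofPred_eq] at hk
    rw [Finset.mem_coe, mem_latBox]
    refine ⟨⟨?_, ?_⟩, ?_, ?_⟩
    · simp only [Nat.abs_cast]; exact_mod_cast hk.1.2.2
    · simp only [Nat.abs_cast]; exact_mod_cast hk.1.1.2
    · intro h
      have := congrArg Prod.fst h
      simp at this
      omega
    · simp only [Int.cast_natCast]
      have := hk.2
      field_simp
      linear_combination -this
  · intro k _ k' _ h
    simp only [Prod.mk.injEq, Nat.cast_inj] at h
    exact Prod.ext h.2 h.1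

set_option maxHeartbeats 2000000 in
/-- The main argument, with T a bound for the divisor function. -/
lemma main_bound (p : ℕ) [Fact p.Prime] (M : Finset (ZMod p)) (hM : ∀ m ∈ M, m ≠ 0) (K : ℕ)
    (hK : 0 < K) (hKM : (p : ℝ) ≤ K * M.card) (hKM4 : (p : ℝ) ^ 3 ≤ (K : ℝ) ^ 4 * M.card)
    (T : ℕ) (hT : ∀ n : ℕ, 1 ≤ n → n ≤ 4 * p ^ 2 → n.divisors.card ≤ T) :
    (((((Finset.Icc 1 K) ×ˢ (Finset.Icc 1 K)) ×ˢ (M ×ˢ M)).filter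
          (fun q => (q.1.1 : ZMod p) * q.2.1 = (q.1.2 : ZMod p) * q.2.2)).card : ℝ) ≤
      10000 * (T : ℝ) ^ 4 * (K : ℝ) ^ 2 * (M.card : ℝ) ^ 2 / p := by
  classical
  have hp : p.Prime := Fact.out
  have hpr : (0 : ℝ) < p := by exact_mod_cast hp.pos
  have hKr : (0 : ℝ) < K := by exact_mod_cast hK
  have hT1 : 1 ≤ T := by
    have := hT 1 le_rfl (by nlinarith [hp.two_le])
    simpa using this
  have hT1r : (1 : ℝ) ≤ T := by exact_mod_cast hT1
  have hsh := fun l : {l : ZMod p // l ≠ 0} => exists_short p l.1 l.2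
  have hsh' : ∀ l : ZMod p, ∃ (a b : ℤ) (s : ℕ), l ≠ 0 → (0 < s ∧ s < p ∧ |a| ≤ s ∧ |b| ≤ s ∧
      (a : ZMod p) ≠ 0 ∧ (b : ZMod p) ≠ 0 ∧ (a : ZMod p) = l * (b : ZMod p) ∧
      ∀ R : ℕ, ((latBox p R l).card : ℝ) ≤ 16 * (R : ℝ) ^ 2 / p + 4 * R / s) := by
    intro l
    by_cases hl : l = 0
    · exact ⟨0, 0, 0, fun h => absurd hl h⟩
    · obtain ⟨a, b, s, h⟩ := exists_short p l hl
      exact ⟨a, b, s, fun _ => h⟩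
  choose a b s hs using hsh'
  have hab : ∀ l, l ≠ 0 → |a l| ≤ s l ∧ |b l| ≤ s l ∧ (a l : ZMod p) ≠ 0 ∧
      (b l : ZMod p) ≠ 0 ∧ (a l : ZMod p) = l * (b l : ZMod p) := by
    intro l hl
    obtain ⟨_, _, h1, h2, h3, h4, h5, _⟩ := hs l hl
    exact ⟨h1, h2, h3, h4, h5⟩
  have hq0 : ∀ q ∈ M ×ˢ M, q.1 / q.2 ≠ 0 := by
    intro q hq
    rw [Finset.mem_product] at hq
    exact div_ne_zero (hM _ hq.1) (hM _ hq.2)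
  set m : ℝ := (M.card : ℝ) with hm
  have hm0 : 0 ≤ m := by positivity
  set σ : ZMod p × ZMod p → ℝ := fun q => 1 / (s (q.1 / q.2) : ℝ) with hσ
  set S : ℝ := ∑ q ∈ M ×ˢ M, σ q with hS
  have hN : ∀ R : ℕ, ((∑ q ∈ M ×ˢ M, (latBox p R (q.1 / q.2)).card : ℕ) : ℝ) ≤
      16 * (R : ℝ) ^ 2 * m ^ 2 / p + 4 * R * S := by
    intro R
    push_cast
    calc _ ≤ ∑ q ∈ M ×ˢ M, (16 * (R : ℝ) ^ 2 / p + 4 * R * σ q) := by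
          refine Finset.sum_le_sum fun q hq => ?_
          have := (hs _ (hq0 q hq)).2.2.2.2.2.2.2 R
          simp only [hσ]
          rw [mul_one_div]
          exact this
      _ = _ := by
          rw [Finset.sum_add_distrib, Finset.sum_const, ← Finset.mul_sum, Finset.card_product]
          simp only [nsmul_eq_mul, Nat.cast_mul]
          rw [← hm]; ring
  set P := (M ×ˢ M).filter (fun q => s (q.1 / q.2) * K < p) with hP
  set F : ℝ := ∑ q ∈ P, σ q with hF
  set Y : ℝ := m ^ 2 * K / p with hY
  have hSF : S ≤ F + Y := by
    rw [hS, ← Finset.sum_filter_add_sum_filter_not (M ×ˢ M) (fun q => s (q.1 / q.2) * K < p)]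
    rw [hF, hP]
    gcongr
    calc _ ≤ ∑ q ∈ (M ×ˢ M).filter (fun q => ¬ s (q.1 / q.2) * K < p), (K : ℝ) / p := by
          refine Finset.sum_le_sum fun q hq => ?_
          rw [Finset.mem_filter] at hq
          have h0 := (hs _ (hq0 q hq.1)).1
          have h0r : (0 : ℝ) < s (q.1 / q.2) := by exact_mod_cast h0
          simp only [hσ]
          rw [div_le_div_iff₀ h0r hpr, one_mul]
          have := not_lt.mp hq.2
          rw [mul_comm]
          exact_mod_cast this
      _ ≤ ∑ q ∈ M ×ˢ M, (K : ℝ) / p := by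
          apply Finset.sum_le_sum_of_subset_of_nonneg (Finset.filter_subset _ _)
          intros; positivity
      _ = _ := by
          rw [Finset.sum_const, Finset.card_product, nsmul_eq_mul, Nat.cast_mul, ← hm, hY]; ring
  have hF0 : 0 ≤ F := Finset.sum_nonneg fun q _ => by simp only [hσ]; positivity
  have hY0 : 0 ≤ Y := by positivity
  have hmY : m ≤ Y := by
    rw [hY, le_div_iff₀ hpr]
    nlinarith
  have hmY2 : m ^ 3 * p / (K : ℝ) ^ 2 ≤ Y ^ 2 := by
    rw [hY, div_pow, div_le_div_iff₀ (by positivity) (by positivity)]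
    have : m ^ 3 * (p : ℝ) ^ 3 ≤ m ^ 3 * ((K : ℝ) ^ 4 * m) := by gcongr
    nlinarith
  -- bound for each dyadic level
  set X : ℝ := 4 * m * T ^ 2 * (64 * m ^ 2 * p / (K : ℝ) ^ 2 + 4 * S) with hX
  have hS0 : 0 ≤ S := Finset.sum_nonneg fun q _ => by simp only [hσ]; positivity
  have hX0 : 0 ≤ X := by positivity
  set L := Nat.log 2 p + 1 with hL
  have hLT : L ≤ T := by
    have h1 : 2 ^ Nat.log 2 p ≤ p := Nat.pow_log_le_self 2 hp.pos.ne'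
    have := hT (2 ^ Nat.log 2 p) Nat.one_le_two_pow (by nlinarith [hp.two_le])
    rw [Nat.divisors_prime_pow Nat.prime_two] at this
    rw [Finset.card_map, Finset.card_range] at this
    exact this
  have hlev : ∀ j : ℕ, (∑ q ∈ P.filter (fun q => Nat.log 2 (s (q.1 / q.2)) = j), σ q) ≤
      2 * Real.sqrt X := by
    intro j
    set Pj := P.filter (fun q => Nat.log 2 (s (q.1 / q.2)) = j) with hPj
    rcases Pj.eq_empty_or_nonempty with he | ⟨q₀, hq₀⟩
    · rw [he]; simp
    have hmem : ∀ q ∈ Pj, q ∈ M ×ˢ M ∧ s (q.1 / q.2) * K < p ∧ 2 ^ j ≤ s (q.1 / q.2) ∧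
        s (q.1 / q.2) < 2 ^ (j + 1) := by
      intro q hq
      rw [hPj, Finset.mem_filter, hP, Finset.mem_filter] at hq
      obtain ⟨⟨h1, h2⟩, h3⟩ := hq
      have h0 := (hs _ (hq0 q h1)).1
      refine ⟨h1, h2, ?_, ?_⟩
      · rw [← h3]; exact Nat.pow_log_le_self 2 h0.ne'
      · rw [← h3]; exact Nat.lt_pow_succ_log_self (by norm_num) _
    have hjK : 2 ^ j * K < p := by
      obtain ⟨h1, h2, h3, h4⟩ := hmem q₀ hq₀
      exact lt_of_le_of_lt (Nat.mul_le_mul_right _ h3) h2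
    set A := 2 ^ (j + 1) with hA
    have hAK : A * K ≤ 2 * p := by rw [hA, pow_succ]; nlinarith
    have hAp : A ≤ 2 * p := le_trans (Nat.le_mul_of_pos_right _ hK) hAK
    have hG := G_bound p M hM a b s hab A T (fun n h1 h2 => hT n h1 (by nlinarith))
    generalize hGdef : ((M ×ˢ M).filter (fun q => s (q.1 / q.2) ≤ A)).card = G at hG
    have hPG : Pj.card ≤ G := by
      rw [← hGdef]
      apply Finset.card_le_card
      intro q hq
      obtain ⟨h1, h2, h3, h4⟩ := hmem q hq
      rw [Finset.mem_filter]
      exact ⟨h1, h4.le⟩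
    have hAr : (0 : ℝ) < A := by positivity
    have hAKr : (A : ℝ) * K ≤ 2 * p := by exact_mod_cast hAK
    have hGr : (G : ℝ) ^ 2 ≤ (A : ℝ) ^ 2 * X := by
      have h1 : (G : ℝ) ^ 2 ≤ m * (4 * (T : ℝ) ^ 2 *
          ((∑ q ∈ M ×ˢ M, (latBox p (A ^ 2) (q.1 / q.2)).card : ℕ) : ℝ)) := by
        rw [hm]; exact_mod_cast hG
      have h2 := hN (A ^ 2)
      have h3 : (A : ℝ) ^ 2 ≤ 4 * (p : ℝ) ^ 2 / (K : ℝ) ^ 2 := by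
        rw [le_div_iff₀ (by positivity), ← mul_pow]
        calc _ ≤ (2 * (p : ℝ)) ^ 2 := by gcongr
          _ = _ := by ring
      have h4 : 16 * (A : ℝ) ^ 2 * m ^ 2 / p ≤ 64 * m ^ 2 * p / (K : ℝ) ^ 2 := by
        calc _ ≤ 16 * (4 * (p : ℝ) ^ 2 / (K : ℝ) ^ 2) * m ^ 2 / p := by gcongr
          _ = _ := by field_simp; ring
      calc (G : ℝ) ^ 2 ≤ _ := h1
        _ ≤ m * (4 * (T : ℝ) ^ 2 * (16 * ((A ^ 2 : ℕ) : ℝ) ^ 2 * m ^ 2 / p +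
            4 * ((A ^ 2 : ℕ) : ℝ) * S)) := by gcongr
        _ = (A : ℝ) ^ 2 * (4 * m * T ^ 2 * (16 * (A : ℝ) ^ 2 * m ^ 2 / p + 4 * S)) := by
            push_cast; ring
        _ ≤ _ := by rw [hX]; gcongr
    have hGs : (G : ℝ) ≤ A * Real.sqrt X := by
      rw [← Real.sqrt_sq hAr.le, ← Real.sqrt_mul (by positivity)]
      exact Real.le_sqrt_of_sq_le hGr
    calc _ ≤ ∑ q ∈ Pj, (2 / (A : ℝ)) := by
          refine Finset.sum_le_sum fun q hq => ?_
          obtain ⟨h1, h2, h3, h4⟩ := hmem q hq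
          have h0 := (hs _ (hq0 q h1)).1
          have h0r : (0 : ℝ) < s (q.1 / q.2) := by exact_mod_cast h0
          simp only [hσ]
          rw [div_le_div_iff₀ h0r hAr, one_mul]
          have : A ≤ 2 * s (q.1 / q.2) := by rw [hA, pow_succ]; omega
          exact_mod_cast this
      _ = Pj.card * (2 / (A : ℝ)) := by rw [Finset.sum_const, nsmul_eq_mul]
      _ ≤ (A * Real.sqrt X) * (2 / (A : ℝ)) := by
          gcongr
          exact le_trans (by exact_mod_cast hPG) hGs
      _ = _ := by field_simp
  have hFL : F ≤ T * (2 * Real.sqrt X) := by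
    have hmaps : ∀ q ∈ P, Nat.log 2 (s (q.1 / q.2)) ∈ Finset.range L := by
      intro q hq
      rw [hP, Finset.mem_filter] at hq
      have h0 := (hs _ (hq0 q hq.1)).2.1
      rw [Finset.mem_range, hL]
      exact Nat.lt_succ_of_le (Nat.log_mono_right h0.le)
    rw [hF, ← Finset.sum_fiberwise_of_maps_to hmaps]
    calc _ ≤ ∑ j ∈ Finset.range L, 2 * Real.sqrt X := Finset.sum_le_sum fun j _ => hlev j
      _ = L * (2 * Real.sqrt X) := by rw [Finset.sum_const, Finset.card_range, nsmul_eq_mul]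
      _ ≤ _ := by gcongr
  have hF2 : F ^ 2 ≤ 4 * (T : ℝ) ^ 2 * X := by
    calc F ^ 2 ≤ (T * (2 * Real.sqrt X)) ^ 2 := by gcongr
      _ = 4 * (T : ℝ) ^ 2 * (Real.sqrt X) ^ 2 := by ring
      _ = _ := by rw [Real.sq_sqrt hX0]
  set Q : ℝ := 1088 * (T : ℝ) ^ 4 with hQ
  have hT4 : 1 ≤ (T : ℝ) ^ 4 := one_le_pow₀ hT1r
  have hF3 : F ^ 2 ≤ Q * (Y ^ 2 + Y * F) := by
    have h1 : m * S ≤ Y * (F + Y) := by gcongr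
    calc F ^ 2 ≤ _ := hF2
      _ = 16 * (T : ℝ) ^ 4 * (64 * (m ^ 3 * p / (K : ℝ) ^ 2) + 4 * (m * S)) := by
          rw [hX]; ring
      _ ≤ 16 * (T : ℝ) ^ 4 * (64 * Y ^ 2 + 4 * (Y * (F + Y))) := by gcongr
      _ ≤ 16 * (T : ℝ) ^ 4 * (68 * (Y ^ 2 + Y * F)) := by
          gcongr
          nlinarith [mul_nonneg hY0 hF0]
      _ = _ := by rw [hQ]; ring
  have hF4 : F ≤ 2 * Q * Y := by
    by_contra hcon
    push Not at hcon
    have hQ1 : 1 ≤ Q := by rw [hQ]; linarith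
    have hQY : 0 ≤ Q * Y := by positivity
    have hFpos : 0 < F := by linarith
    have h1 : Y ≤ Q * Y := by nlinarith
    have h2 : Q * Y * Y ≤ (Q * Y) * F / 2 := by
      have : Y ≤ F / 2 := by linarith
      nlinarith
    nlinarith
  have hJ : (((((Finset.Icc 1 K) ×ˢ (Finset.Icc 1 K)) ×ˢ (M ×ˢ M)).filter
          (fun q => (q.1.1 : ZMod p) * q.2.1 = (q.1.2 : ZMod p) * q.2.2)).card : ℝ) ≤
      16 * (K : ℝ) ^ 2 * m ^ 2 / p + 4 * K * S :=
    le_trans (by exact_mod_cast J_bound p M hM K) (hN K)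
  refine hJ.trans ?_
  calc _ ≤ 16 * (K : ℝ) ^ 2 * m ^ 2 / p + 4 * K * (2 * Q * Y + Y) := by
        gcongr; linarith
    _ = (20 + 8 * Q) * ((K : ℝ) ^ 2 * m ^ 2 / p) := by rw [hY]; ring
    _ ≤ (10000 * (T : ℝ) ^ 4) * ((K : ℝ) ^ 2 * m ^ 2 / p) := by
        gcongr; rw [hQ]; linarith
    _ = _ := by ring

/-- Lemma 2.2: under the stated conditions on K and M,
J(𝓚,𝓜) ≤ K²M²p^{-1+o(1)}. -/
theorem stmt_5 :
    ∀ ε : ℝ, 0 < ε → ∃ C : ℝ, 0 < C ∧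
      ∀ (p : ℕ), p.Prime → ∀ (K : ℕ),
      ∀ (M : Finset (ZMod p)), (∀ m ∈ M, m ≠ 0) →
      ((K < p ∧ (p : ℝ) ^ ((2:ℝ)/3) ≤ (K : ℝ) ∧ (p : ℝ) ≤ (K : ℝ) * (M.card : ℝ)) ∨
       ((K : ℝ) < (p : ℝ) ^ ((2:ℝ)/3) ∧ (p : ℝ) ^ ((1:ℝ)/3) ≤ (M.card : ℝ) ∧
        (p : ℝ) ^ ((3:ℝ)/4) ≤ (K : ℝ) * (M.card : ℝ) ^ ((1:ℝ)/4))) →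
      (((((Finset.Icc 1 K) ×ˢ (Finset.Icc 1 K)) ×ˢ (M ×ˢ M)).filter
          (fun q => (q.1.1 : ZMod p) * q.2.1 = (q.1.2 : ZMod p) * q.2.2)).card : ℝ) ≤
        C * (K : ℝ) ^ 2 * (M.card : ℝ) ^ 2 * (p : ℝ) ^ (-(1:ℝ) + ε) := by
  intro ε hε
  obtain ⟨C, hC1, hC⟩ := divisor_bound (ε / 8) (by positivity)
  refine ⟨10000 * (C * 4 ^ (ε / 8)) ^ 4, by positivity, ?_⟩
  intro p hp K M hM hcond
  have : Fact p.Prime := ⟨hp⟩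
  have hpr : (0 : ℝ) < p := by exact_mod_cast hp.pos
  have hm0 : (0 : ℝ) ≤ M.card := by positivity
  have hK0 : (0 : ℝ) ≤ K := by positivity
  have hconds : 0 < K ∧ (p : ℝ) ≤ K * M.card ∧ (p : ℝ) ^ 3 ≤ (K : ℝ) ^ 4 * M.card := by
    rcases hcond with ⟨_, h1, h2⟩ | ⟨_, h1, h2⟩
    · have hKpos : (0 : ℝ) < K := lt_of_lt_of_le (by positivity) h1
      refine ⟨by exact_mod_cast hKpos, h2, ?_⟩
      have h3 : (p : ℝ) ^ 2 ≤ (K : ℝ) ^ 3 := by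
        calc (p : ℝ) ^ 2 = ((p : ℝ) ^ ((2:ℝ)/3)) ^ 3 := by
              rw [← Real.rpow_natCast, ← Real.rpow_natCast, ← Real.rpow_mul hpr.le]; norm_num
          _ ≤ _ := by gcongr
      calc (p : ℝ) ^ 3 = (p : ℝ) ^ 2 * p := by ring
        _ ≤ (K : ℝ) ^ 3 * (K * M.card) := by gcongr
        _ = _ := by ring
    · have h4 : (p : ℝ) ^ 3 ≤ (K : ℝ) ^ 4 * M.card := by
        calc (p : ℝ) ^ 3 = ((p : ℝ) ^ ((3:ℝ)/4)) ^ 4 := by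
              rw [← Real.rpow_natCast, ← Real.rpow_natCast, ← Real.rpow_mul hpr.le]; norm_num
          _ ≤ ((K : ℝ) * (M.card : ℝ) ^ ((1:ℝ)/4)) ^ 4 := by gcongr
          _ = (K : ℝ) ^ 4 * ((M.card : ℝ) ^ ((1:ℝ)/4)) ^ 4 := by ring
          _ = _ := by
              congr 1
              rw [← Real.rpow_natCast, ← Real.rpow_mul hm0]; norm_num
      have h5 : (p : ℝ) ≤ (M.card : ℝ) ^ 3 := by
        calc (p : ℝ) = ((p : ℝ) ^ ((1:ℝ)/3)) ^ 3 := by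
              rw [← Real.rpow_natCast, ← Real.rpow_mul hpr.le]; norm_num
          _ ≤ _ := by gcongr
      refine ⟨?_, ?_, h4⟩
      · rcases Nat.eq_zero_or_pos K with h | h
        · subst h
          exfalso
          have : (0 : ℝ) < (p : ℝ) ^ 3 := by positivity
          norm_num at h4
          linarith
        · exact h
      · have h6 : (p : ℝ) ^ 4 ≤ ((K : ℝ) * M.card) ^ 4 := by
          calc (p : ℝ) ^ 4 = (p : ℝ) ^ 3 * p := by ring
            _ ≤ ((K : ℝ) ^ 4 * M.card) * (M.card : ℝ) ^ 3 := by gcongr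
            _ = _ := by ring
        exact le_of_pow_le_pow_left₀ (by norm_num) (by positivity) h6
  obtain ⟨hK, hKM, hKM4⟩ := hconds
  set B : ℝ := C * ((4 * p ^ 2 : ℕ) : ℝ) ^ (ε / 8) with hB
  have hB0 : 0 ≤ B := by positivity
  have hmain := main_bound p M hM K hK hKM hKM4 ⌊B⌋₊ (by
    intro n h1 h2
    apply Nat.le_floor
    refine (hC n h1).trans ?_
    rw [hB]
    gcongr)
  refine hmain.trans ?_
  have hfl : ((⌊B⌋₊ : ℕ) : ℝ) ≤ B := Nat.floor_le hB0
  have hB4 : B ^ 4 = (C * 4 ^ (ε / 8)) ^ 4 * (p : ℝ) ^ ε := by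
    have : ((4 * p ^ 2 : ℕ) : ℝ) ^ (ε / 8) = 4 ^ (ε / 8) * (p : ℝ) ^ (ε / 4) := by
      push_cast
      rw [Real.mul_rpow (by norm_num) (by positivity), ← Real.rpow_natCast (p : ℝ) 2,
        ← Real.rpow_mul hpr.le]
      congr 2
      push_cast; ring
    rw [hB, this, ← mul_assoc, mul_pow _ ((p : ℝ) ^ (ε / 4)), ← Real.rpow_natCast ((p : ℝ) ^ (ε / 4)),
      ← Real.rpow_mul hpr.le]
    congr 2
    push_cast; ring
  calc _ ≤ 10000 * B ^ 4 * (K : ℝ) ^ 2 * (M.card : ℝ) ^ 2 / p := by gcongr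
    _ = _ := by
        rw [hB4, Real.rpow_add hpr, Real.rpow_neg_one]
        field_simp
end

section
/- Fix a nonzero integer s. For every real ε > 0 there exists C > 0, depending only on s and ε, with the following property. Let p be a prime, let L and H be integers with {L+1, …, L+H} ⊆ {1, …, p−1}, and let 𝓜 ⊆ 𝔽_p^* be a set of cardinality M. Let J_s(L, 𝓗, 𝓜) denote the number of quadruples (m_1, m_2, x_1, x_2) with m_1, m_2 ∈ 𝓜, x_1, x_2 ∈ {L+1, …, L+H}, satisfying m_1·x_1^{−s} ≡ m_2·x_2^{−s} (mod p). Then: (i) if H ≥ p^{2/3}, then J_s(L, 𝓗, 𝓜) ≤ C·(H^2·M^2/p + H·M·p^{ε}); (ii) if H < p^{2/3} and M ≥ p^{1/3}, then J_s(L, 𝓗, 𝓜) ≤ C·(H^2·M^2/p + H·M^{7/4}·p^{−1/4+ε} + M^2); (iii) if H < p^{2/3} and M < p^{1/3}, then J_s(L, 𝓗, 𝓜) ≤ C·(H·M·p^{ε} + M^2). -/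
open Finset

lemma aux_div (ε : ℝ) (hε : 0 < ε) : ∃ C : ℝ, 1 ≤ C ∧ ∀ n : ℕ, n ≠ 0 →
    (n.divisors.card : ℝ) ≤ C * (n : ℝ) ^ ε := by
  obtain ⟨B, hB⟩ := exists_nat_gt ((2:ℝ) ^ (1/ε))
  have hl : 0 < Real.log 2 := Real.log_pos (by norm_num)
  have hel : 0 < ε * Real.log 2 := by positivity
  set c : ℝ := 1 + 1 / (ε * Real.log 2) with hc
  have hc1 : 1 ≤ c := by rw [hc]; have : 0 < 1 / (ε * Real.log 2) := by positivity
                         linarith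
  refine ⟨c ^ B, one_le_pow₀ hc1, ?_⟩
  intro n hn
  rw [Nat.card_divisors hn]
  have key : ∀ q ∈ n.primeFactors, ((n.factorization q + 1 : ℕ) : ℝ) ≤
      (if q < B then c else 1) * ((q : ℝ) ^ (n.factorization q)) ^ ε := by
    intro q hq
    have hq2 : 2 ≤ q := (Nat.prime_of_mem_primeFactors hq).two_le
    have hq2' : (2:ℝ) ≤ q := by exact_mod_cast hq2
    set e := n.factorization q
    have hrw : ((q : ℝ) ^ e) ^ ε = ((q : ℝ) ^ ε) ^ e := by
      rw [← Real.rpow_natCast, ← Real.rpow_natCast, ← Real.rpow_mul (by positivity),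
        ← Real.rpow_mul (by positivity), mul_comm]
    rw [hrw]
    split_ifs with h
    · have h1 : (1 + ε * Real.log 2) ≤ (q:ℝ) ^ ε := by
        have : (2:ℝ) ^ ε ≤ (q:ℝ)^ε := Real.rpow_le_rpow (by norm_num) hq2' hε.le
        have h3 : (2:ℝ) ^ ε = Real.exp (ε * Real.log 2) := by
          rw [Real.rpow_def_of_pos (by norm_num), mul_comm]
        have := Real.add_one_le_exp (ε * Real.log 2)
        linarith
      have h2 : 1 + (e:ℝ) * (ε * Real.log 2) ≤ ((q:ℝ) ^ ε) ^ e := by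
        calc 1 + (e:ℝ) * (ε * Real.log 2) ≤ (1 + ε * Real.log 2) ^ e :=
              one_add_mul_le_pow (by linarith) e
          _ ≤ _ := pow_le_pow_left₀ (by positivity) h1 e
      have h4 : ((e + 1 : ℕ) : ℝ) ≤ c * (1 + (e:ℝ) * (ε * Real.log 2)) := by
        have : c * (1 + (e:ℝ) * (ε * Real.log 2)) = 1 + 1 / (ε * Real.log 2) + e * (ε * Real.log 2) + e := by
          rw [hc]; field_simp; ring
        rw [this]; push_cast
        have : 0 < 1 / (ε * Real.log 2) := by positivity
        have : 0 ≤ e * (ε * Real.log 2) := by positivity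
        linarith
      exact h4.trans (mul_le_mul_of_nonneg_left h2 (by linarith))
    · have h1 : (2:ℝ) ≤ (q:ℝ) ^ ε := by
        have : (2:ℝ) ^ (1/ε) ≤ q := hB.le.trans (by exact_mod_cast (not_lt.mp h))
        calc (2:ℝ) = ((2:ℝ) ^ (1/ε)) ^ ε := by
              rw [← Real.rpow_mul (by norm_num)]; field_simp; simp
          _ ≤ _ := Real.rpow_le_rpow (by positivity) this hε.le
      rw [one_mul]
      calc ((e + 1 : ℕ) : ℝ) ≤ (2:ℝ) ^ e := by
            exact_mod_cast Nat.lt_two_pow_self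
        _ ≤ _ := pow_le_pow_left₀ (by norm_num) h1 e
  push_cast
  have h5 : ∏ q ∈ n.primeFactors, ((n.factorization q : ℝ) + 1) ≤
      ∏ q ∈ n.primeFactors, ((if q < B then c else 1) * ((q : ℝ) ^ (n.factorization q)) ^ ε) := by
    apply Finset.prod_le_prod
    · intros; positivity
    · intro q hq; have := key q hq; push_cast at this; exact this
  refine h5.trans ?_
  rw [Finset.prod_mul_distrib]
  have h6 : ∏ q ∈ n.primeFactors, ((q : ℝ) ^ (n.factorization q)) ^ ε = (n:ℝ) ^ ε := by
    rw [Real.finsetProd_rpow]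
    · congr 1
      conv_rhs => rw [← Nat.prod_factorization_pow_eq_self hn]
      rw [Finsupp.prod]; push_cast; rfl
    · intros; positivity
  rw [h6]
  apply mul_le_mul_of_nonneg_right _ (by positivity)
  rw [← Finset.prod_filter, Finset.prod_const]
  apply pow_le_pow_right₀ hc1
  calc _ ≤ (Finset.range B).card := by
        apply Finset.card_le_card
        intro q; simp only [mem_filter, mem_range]; tauto
    _ = B := by simp

noncomputable def NN {p : ℕ} (A : Finset ℤ) (l : ZMod p) : ℕ :=
  ((A ×ˢ A).filter (fun z => (z.1 : ZMod p) = l * (z.2 : ZMod p))).card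

def IsRho {p : ℕ} (l : ZMod p) (r : ℕ) : Prop :=
  ∃ u v : ℤ, ¬ (u = 0 ∧ v = 0) ∧ (u : ZMod p) = l * (v : ZMod p) ∧ |u| ≤ r ∧ |v| ≤ r

lemma exists_isRho {p : ℕ} (hp : p.Prime) (l : ZMod p) : IsRho l (Nat.sqrt p) := by
  have := Fact.mk hp
  set n := Nat.sqrt p
  have hcard : (Finset.univ : Finset (ZMod p)).card < (range (n+1) ×ˢ range (n+1)).card := by
    rw [Finset.card_univ, ZMod.card, card_product, card_range]
    exact Nat.lt_succ_sqrt p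
  obtain ⟨a, ha, b, hb, hab, h⟩ := Finset.exists_ne_map_eq_of_card_lt_of_maps_to hcard
    (f := fun z : ℕ × ℕ => (z.1 : ZMod p) - l * (z.2 : ZMod p)) (fun _ _ => by simp)
  simp only [mem_product, mem_range] at ha hb
  refine ⟨(a.1 : ℤ) - b.1, (a.2 : ℤ) - b.2, ?_, ?_, ?_, ?_⟩
  · rintro ⟨h1, h2⟩
    apply hab
    ext <;> omega
  · push_cast
    linear_combination h
  · rw [abs_le]; omega
  · rw [abs_le]; omega

open Classical in
noncomputable def rho {p : ℕ} (l : ZMod p) : ℕ := sInf {r | IsRho l r}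

lemma rho_spec {p : ℕ} (hp : p.Prime) (l : ZMod p) : IsRho l (rho l) :=
  Nat.sInf_mem (s := {r | IsRho l r}) ⟨_, exists_isRho hp l⟩

lemma rho_le {p : ℕ} (l : ZMod p) {r : ℕ} (h : IsRho l r) : rho l ≤ r := Nat.sInf_le h

lemma rho_pos {p : ℕ} (hp : p.Prime) (l : ZMod p) : 1 ≤ rho l := by
  by_contra h
  have h0 : rho l = 0 := by omega
  obtain ⟨u, v, h1, h2, h3, h4⟩ := rho_spec hp l
  rw [h0] at h3 h4
  apply h1
  simp at h3 h4
  exact ⟨h3, h4⟩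

lemma rho_sq {p : ℕ} (hp : p.Prime) (l : ZMod p) : rho l * rho l ≤ p :=
  (Nat.mul_self_le_mul_self (rho_le l (exists_isRho hp l))).trans (Nat.sqrt_le p)

/-- number of floors -/
lemma floor_card (a b : ℤ) (h : a ≤ b) (q : ℕ) (hq : 0 < q) :
    ((Icc (a / (q:ℤ)) (b / (q:ℤ))).card : ℝ) ≤ ((b - a : ℤ) : ℝ) / q + 2 := by
  have hqz : (0:ℤ) < q := by exact_mod_cast hq
  have h1 : a / (q:ℤ) ≤ b / (q:ℤ) := Int.ediv_le_ediv hqz h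
  rw [Int.card_Icc]
  have h2 : (((b / (q:ℤ) + 1 - a / (q:ℤ)).toNat : ℕ) : ℝ) = ((b / (q:ℤ) + 1 - a / (q:ℤ) : ℤ) : ℝ) := by
    have : (((b / (q:ℤ) + 1 - a / (q:ℤ)).toNat : ℕ) : ℤ) = (b / (q:ℤ) + 1 - a / (q:ℤ) : ℤ) :=
      Int.toNat_of_nonneg (by omega)
    exact_mod_cast this
  rw [h2]
  have hqr : (0:ℝ) < q := by exact_mod_cast hq
  rw [← sub_le_iff_le_add, le_div_iff₀ hqr]
  have e1 := Int.mul_ediv_add_emod b q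
  have e2 := Int.mul_ediv_add_emod a q
  have e3 := Int.emod_nonneg b hqz.ne'
  have e4 := Int.emod_lt_of_pos a hqz
  have : ((b / (q:ℤ) + 1 - a / (q:ℤ)) - 2) * q ≤ b - a := by nlinarith
  exact_mod_cast this

lemma NN_le {p : ℕ} (hp : p.Prime) (l : ZMod p) (a : ℤ) (h : ℕ) (A : Finset ℤ)
    (hA : A ⊆ Icc a (a + h)) :
    (NN A l : ℝ) ≤ 4 * (h:ℝ)^2 / p + 10 * h / rho l + 4 := by
  obtain ⟨u, v, h1, h2, h3, h4⟩ := rho_spec hp l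
  have hr1 := rho_pos hp l
  have hmin : ∀ x y : ℤ, (x : ZMod p) = l * (y : ZMod p) → |x| < rho l → |y| < rho l →
      x = 0 ∧ y = 0 := by
    intro x y hxy hx hy
    by_contra hne
    have := rho_le l (r := rho l - 1) ⟨x, y, hne, hxy, by omega, by omega⟩
    omega
  have hor : |u| = rho l ∨ |v| = rho l := by
    by_contra hne
    push Not at hne
    exact h1 (hmin u v h2 (lt_of_le_of_ne h3 hne.1) (lt_of_le_of_ne h4 hne.2))
  set r := rho l with hr
  have hpz : (0:ℤ) < p := by exact_mod_cast hp.pos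
  have hrz : (0:ℤ) < r := by exact_mod_cast hr1
  let g : ℤ × ℤ → ℤ := fun z => if |u| = r then z.1 else z.2
  let c : ℤ := u * a - v * a
  have hdvd : ∀ z ∈ (A ×ˢ A).filter (fun z => (z.1 : ZMod p) = l * (z.2 : ZMod p)),
      (p:ℤ) ∣ u * z.2 - v * z.1 := by
    intro z hz
    rw [mem_filter] at hz
    rw [← ZMod.intCast_zmod_eq_zero_iff_dvd]
    push_cast
    rw [hz.2, h2]; ring
  have hle : NN A l ≤ (Icc ((c - 2 * r * h) / (p:ℤ)) ((c + 2 * r * h) / (p:ℤ)) ×ˢ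
      Icc (a / (r:ℤ)) ((a + h) / (r:ℤ))).card := by
    unfold NN
    apply Finset.card_le_card_of_injOn (fun z => ((u * z.2 - v * z.1) / (p:ℤ), g z / (r:ℤ)))
    · intro z hz
      have hz' := hz
      simp only [coe_filter, Set.mem_ofPred_eq, mem_product] at hz'
      obtain ⟨⟨hx, hy⟩, -⟩ := hz'
      have hx := mem_Icc.mp (hA hx)
      have hy := mem_Icc.mp (hA hy)
      simp only [coe_product, Set.mem_prod, coe_Icc, Set.mem_Icc]
      have b1 : |u * (z.2 - a)| ≤ r * h := by
        rw [abs_mul]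
        exact mul_le_mul h3 (by rw [abs_le]; constructor <;> linarith) (abs_nonneg _) hrz.le
      have b2 : |v * (z.1 - a)| ≤ r * h := by
        rw [abs_mul]
        exact mul_le_mul h4 (by rw [abs_le]; constructor <;> linarith) (abs_nonneg _) hrz.le
      rw [abs_le] at b1 b2
      refine ⟨⟨Int.ediv_le_ediv hpz ?_, Int.ediv_le_ediv hpz ?_⟩,
        Int.ediv_le_ediv hrz ?_, Int.ediv_le_ediv hrz ?_⟩
      · simp only [c]; linarith
      · simp only [c]; linarith
      · simp only [g]; split_ifs <;> linarith
      · simp only [g]; split_ifs <;> linarith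
    · intro z hz w hw hzw
      simp only [Prod.mk.injEq] at hzw
      obtain ⟨e1, e2⟩ := hzw
      have d1 := hdvd z hz
      have d2 := hdvd w hw
      have e3 : u * z.2 - v * z.1 = u * w.2 - v * w.1 := by
        rw [← Int.mul_ediv_cancel' d1, ← Int.mul_ediv_cancel' d2, e1]
      have e4 : |g z - g w| < r := by
        have f1 := Int.mul_ediv_add_emod (g z) r
        have f2 := Int.mul_ediv_add_emod (g w) r
        have f3 := Int.emod_nonneg (g z) hrz.ne'
        have f4 := Int.emod_nonneg (g w) hrz.ne'
        have f5 := Int.emod_lt_of_pos (g z) hrz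
        have f6 := Int.emod_lt_of_pos (g w) hrz
        rw [e2] at f1
        rw [abs_lt]; constructor <;> linarith
      simp only [coe_filter, Set.mem_ofPred_eq] at hz hw
      have e5 : ((z.1 - w.1 : ℤ) : ZMod p) = l * ((z.2 - w.2 : ℤ) : ZMod p) := by
        push_cast; rw [hz.2, hw.2]; ring
      have e6 : u * (z.2 - w.2) = v * (z.1 - w.1) := by linarith
      have e7 : |u| * |z.2 - w.2| = |v| * |z.1 - w.1| := by rw [← abs_mul, ← abs_mul, e6]
      have : |z.1 - w.1| < r ∧ |z.2 - w.2| < r := by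
        by_cases hu : |u| = r
        · simp only [g, if_pos hu] at e4
          refine ⟨e4, ?_⟩
          rw [hu] at e7
          have : (r:ℤ) * |z.2 - w.2| ≤ r * |z.1 - w.1| := by
            rw [e7]; exact mul_le_mul_of_nonneg_right h4 (abs_nonneg _)
          exact lt_of_le_of_lt (le_of_mul_le_mul_left this hrz) e4
        · simp only [g, if_neg hu] at e4
          refine ⟨?_, e4⟩
          have hv := hor.resolve_left hu
          rw [hv] at e7
          have : (r:ℤ) * |z.1 - w.1| ≤ r * |z.2 - w.2| := by
            rw [← e7]; exact mul_le_mul_of_nonneg_right h3 (abs_nonneg _)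
          exact lt_of_le_of_lt (le_of_mul_le_mul_left this hrz) e4
      have := hmin _ _ e5 this.1 this.2
      ext <;> omega
  have hpr : (0:ℝ) < p := by exact_mod_cast hp.pos
  have hrr : (0:ℝ) < r := by exact_mod_cast hr1
  have hh : (0:ℝ) ≤ h := by positivity
  calc (NN A l : ℝ) ≤ _ := Nat.cast_le.mpr hle
    _ ≤ (4 * r * h / p + 2) * (h / r + 2) := by
      rw [card_product]
      push_cast
      have k1 := floor_card (c - 2 * r * h) (c + 2 * r * h)
        (by have : (0:ℤ) ≤ 2 * r * h := by positivity
            linarith) p hp.pos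
      have k2 := floor_card a (a + h) (by omega) r hr1
      refine mul_le_mul (k1.trans ?_) (k2.trans ?_) (by positivity) (by positivity)
      · push_cast; apply le_of_eq; ring
      · push_cast; apply le_of_eq; ring
    _ = 4 * (h:ℝ)^2 / p + 2 * h / r + 8 * (r * h / p) + 4 := by
      field_simp; ring
    _ ≤ _ := by
      have k3 : (r:ℝ) * h / p ≤ h / r := by
        rw [div_le_div_iff₀ hpr hrr]
        have : (r:ℝ) * r ≤ p := by exact_mod_cast rho_sq hp l
        nlinarith
      have : 10 * (h:ℝ) / r = 2 * h / r + 8 * (h / r) := by ring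
      rw [this]; linarith

noncomputable def RR {p : ℕ} (k : ℕ) (M : Finset (ZMod p)) (l : ZMod p) : ℕ :=
  ((M ×ˢ M).filter (fun q => q.2 = q.1 * l ^ k)).card

noncomputable def JJ {p : ℕ} (k : ℕ) (M : Finset (ZMod p)) (A : Finset ℤ) : ℕ :=
  (((M ×ˢ M) ×ˢ (A ×ˢ A)).filter
    (fun q => q.1.1 * (q.2.1 : ZMod p) ^ k = q.1.2 * (q.2.2 : ZMod p) ^ k)).card

noncomputable def Bx (n : ℕ) : Finset ℤ := (Icc (-(n:ℤ)) n).erase 0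

lemma mem_Bx {n : ℕ} {x : ℤ} : x ∈ Bx n ↔ x ≠ 0 ∧ |x| ≤ n := by
  rw [Bx, mem_erase, mem_Icc, abs_le]

lemma cast_ne_zero_of_abs_lt {p : ℕ} {x : ℤ} (h0 : x ≠ 0) (h : |x| < p) : (x : ZMod p) ≠ 0 := by
  rw [Ne, ZMod.intCast_zmod_eq_zero_iff_dvd]
  intro hd
  exact h0 (Int.eq_zero_of_abs_lt_dvd hd h)

lemma Bx_ne {p n : ℕ} (hn : n < p) : ∀ x ∈ Bx n, (x : ZMod p) ≠ 0 := by
  intro x hx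
  rw [mem_Bx] at hx
  exact cast_ne_zero_of_abs_lt hx.1 (by omega)

lemma JJ_eq {p : ℕ} [Fact p.Prime] (k : ℕ) (M : Finset (ZMod p)) (A : Finset ℤ)
    (hA : ∀ x ∈ A, (x : ZMod p) ≠ 0) : JJ k M A = ∑ l : ZMod p, RR k M l * NN A l := by
  unfold JJ
  rw [Finset.card_eq_sum_card_fiberwise (f := fun q => (q.2.1 : ZMod p) / (q.2.2 : ZMod p))
    (t := Finset.univ) (fun _ _ => by simp)]
  apply Finset.sum_congr rfl
  intro l _
  unfold RR NN
  rw [← card_product]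
  congr 1
  ext ⟨⟨m1, m2⟩, ⟨x1, x2⟩⟩
  simp only [mem_filter, mem_product]
  constructor
  · rintro ⟨⟨⟨⟨h1, h2⟩, h3, h4⟩, h5⟩, h6⟩
    have := hA x2 h4
    have e : (x1 : ZMod p) = l * x2 := by rw [← h6]; field_simp
    refine ⟨⟨⟨h1, h2⟩, ?_⟩, ⟨h3, h4⟩, e⟩
    rw [e] at h5
    have : (x2 : ZMod p) ^ k ≠ 0 := pow_ne_zero _ this
    apply mul_right_cancel₀ this
    rw [← h5]; ring
  · rintro ⟨⟨⟨h1, h2⟩, h5⟩, ⟨h3, h4⟩, h6⟩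
    have := hA x2 h4
    refine ⟨⟨⟨⟨h1, h2⟩, h3, h4⟩, ?_⟩, ?_⟩
    · rw [h6, h5]; ring
    · rw [h6]; field_simp

lemma sum_RR {p : ℕ} [Fact p.Prime] (k : ℕ) (hk : 1 ≤ k) (M : Finset (ZMod p))
    (hM : ∀ m ∈ M, m ≠ 0) : ∑ l : ZMod p, RR k M l ≤ k * M.card ^ 2 := by
  classical
  unfold RR
  simp_rw [Finset.card_filter]
  rw [Finset.sum_comm]
  calc _ ≤ ∑ q ∈ M ×ˢ M, k := by
        apply Finset.sum_le_sum
        intro q hq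
        rw [mem_product] at hq
        rw [← Finset.card_filter]
        calc _ ≤ (Polynomial.nthRoots k (q.2 / q.1)).toFinset.card := by
              apply Finset.card_le_card
              intro l hl
              rw [mem_filter] at hl
              rw [Multiset.mem_toFinset, Polynomial.mem_nthRoots hk, hl.2]
              have := hM _ hq.1
              field_simp
          _ ≤ _ := (Multiset.toFinset_card_le _).trans (Polynomial.card_nthRoots _ _)
    _ = _ := by simp [card_product]; ring

lemma RR_zero {p : ℕ} (k : ℕ) (hk : 1 ≤ k) (M : Finset (ZMod p))
    (hM : ∀ m ∈ M, m ≠ 0) : RR k M 0 = 0 := by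
  unfold RR
  rw [Finset.card_eq_zero, Finset.filter_eq_empty_iff]
  intro q hq
  rw [mem_product] at hq
  rw [zero_pow (by omega), mul_zero]
  exact hM _ hq.2

lemma NN_pos {p : ℕ} (hp : p.Prime) (l : ZMod p) (hl : l ≠ 0) (n : ℕ) (hn : n < p)
    (h : rho l ≤ n) : 1 ≤ NN (Bx n) l := by
  have := Fact.mk hp
  obtain ⟨u, v, h1, h2, h3, h4⟩ := rho_spec hp l
  have hu : u ≠ 0 := by
    intro h0
    apply h1
    refine ⟨h0, ?_⟩
    by_contra hv
    have := cast_ne_zero_of_abs_lt (p := p) hv (by omega)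
    rw [h0] at h2
    simp [hl] at h2
    exact this h2
  have hv : v ≠ 0 := by
    intro h0
    rw [h0] at h2
    have := cast_ne_zero_of_abs_lt (p := p) hu (by omega)
    simp at h2
    exact this h2
  unfold NN
  rw [Nat.one_le_iff_ne_zero, Finset.card_ne_zero]
  refine ⟨(u, v), ?_⟩
  simp only [mem_filter, mem_product, mem_Bx]
  exact ⟨⟨⟨hu, by omega⟩, hv, by omega⟩, h2⟩

lemma fact_count (n : ℕ) (U : ℤ) (hU : U ≠ 0) :
    ((Bx n ×ˢ Bx n).filter (fun z => z.1 * z.2 = U)).card ≤ 2 * U.natAbs.divisors.card := by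
  have : 2 * U.natAbs.divisors.card = ((Finset.univ : Finset Bool) ×ˢ U.natAbs.divisors).card := by
    rw [card_product]; simp
  rw [this]
  apply Finset.card_le_card_of_injOn (fun z => (decide (0 < z.1), z.1.natAbs))
  · intro z hz
    simp only [coe_filter, Set.mem_ofPred_eq] at hz
    simp only [coe_product, Set.mem_prod, coe_univ, Set.mem_univ, true_and, mem_coe,
      Nat.mem_divisors]
    refine ⟨?_, by simpa using hU⟩
    rw [← hz.2, Int.natAbs_mul]
    exact dvd_mul_right _ _
  · intro z hz w hw h
    simp only [coe_filter, Set.mem_ofPred_eq, mem_product, mem_Bx] at hz hw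
    simp only [Prod.mk.injEq, decide_eq_decide] at h
    have e : z.1 = w.1 := by omega
    have e2 : z.2 = w.2 := by
      apply mul_left_cancel₀ hz.1.1.1
      rw [hz.2, ← hw.2, e]
    exact Prod.ext e e2

lemma JJ_sq {p : ℕ} [Fact p.Prime] (k : ℕ) (M : Finset (ZMod p)) (n t : ℕ) (hn : n * n < p)
    (ht : ∀ U : ℤ, U ≠ 0 → |U| ≤ (n * n : ℕ) → 
      ((Bx n ×ˢ Bx n).filter (fun z => z.1 * z.2 = U)).card ≤ t) :
    JJ k M (Bx n) ^ 2 ≤ M.card * (t * t * JJ k M (Bx (n * n))) := by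
  classical
  have hn' : n < p := lt_of_le_of_lt (Nat.le_mul_self n) hn
  have hne := Bx_ne hn'
  let A2 := Bx n ×ˢ Bx n
  let D : ZMod p → Finset (ℤ × ℤ) := fun m =>
    A2.filter (fun z => m * ((z.1 : ZMod p) / (z.2 : ZMod p)) ^ k ∈ M)
  have h1 : JJ k M (Bx n) ≤ ∑ m ∈ M, (D m).card := by
    rw [← Finset.card_sigma]
    unfold JJ
    apply Finset.card_le_card_of_injOn (fun q => ⟨q.1.1, q.2⟩)
    · rintro ⟨⟨m1, m2⟩, x1, x2⟩ hq
      simp only [coe_filter, Set.mem_ofPred_eq, mem_product] at hq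
      obtain ⟨⟨⟨a1, a2⟩, a3, a4⟩, a5⟩ := hq
      have := hne x2 a4
      simp only [coe_sigma, Set.mem_sigma_iff, mem_coe, D, mem_filter, A2, mem_product]
      refine ⟨a1, ⟨a3, a4⟩, ?_⟩
      rw [div_pow, ← mul_div_assoc, a5, mul_div_assoc, div_self (pow_ne_zero _ this), mul_one]
      exact a2
    · rintro ⟨⟨m1, m2⟩, x1, x2⟩ hq ⟨⟨m1', m2'⟩, x1', x2'⟩ hq' h
      simp only [coe_filter, Set.mem_ofPred_eq, mem_product] at hq hq'
      simp only [Sigma.mk.injEq, heq_eq_eq, Prod.mk.injEq] at h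
      obtain ⟨rfl, rfl, rfl⟩ := h
      have := hne x2 hq.1.2.2
      have e : m2 = m2' := by
        apply mul_right_cancel₀ (pow_ne_zero k this)
        rw [← hq.2, hq'.2]
      rw [e]
  have h2 : ∑ m ∈ M, (D m).card ^ 2 ≤ t * t * JJ k M (Bx (n * n)) := by
    have : ∑ m ∈ M, (D m).card ^ 2 = (M.sigma (fun m => D m ×ˢ D m)).card := by
      rw [Finset.card_sigma]
      apply Finset.sum_congr rfl
      intro m _
      rw [card_product, sq]
    rw [this]
    unfold JJ
    apply Finset.card_le_mul_card_image_of_maps_to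
      (f := fun w : (_ : ZMod p) × ((ℤ × ℤ) × (ℤ × ℤ)) =>
        (((w.1 * ((w.2.1.1 : ZMod p) / (w.2.1.2 : ZMod p)) ^ k,
          w.1 * ((w.2.2.1 : ZMod p) / (w.2.2.2 : ZMod p)) ^ k) : ZMod p × ZMod p),
          ((w.2.2.1 * w.2.1.2, w.2.1.1 * w.2.2.2) : ℤ × ℤ)))
    · rintro ⟨m, ⟨x1, x2⟩, y1, y2⟩ hw
      simp only [mem_sigma, mem_product, D, A2, mem_filter] at hw
      obtain ⟨a0, ⟨⟨a1, a2⟩, a3⟩, ⟨a4, a5⟩, a6⟩ := hw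
      have n2 := hne x2 a2
      have n4 := hne y2 a5
      rw [mem_Bx] at a1 a2 a4 a5
      simp only [mem_filter, mem_product, mem_Bx]
      refine ⟨⟨⟨a3, a6⟩, ⟨mul_ne_zero a4.1 a2.1, ?_⟩, ⟨mul_ne_zero a1.1 a5.1, ?_⟩⟩, ?_⟩
      · rw [abs_mul]; push_cast; exact mul_le_mul a4.2 a2.2 (abs_nonneg _) (by positivity)
      · rw [abs_mul]; push_cast; exact mul_le_mul a1.2 a5.2 (abs_nonneg _) (by positivity)
      · push_cast
        rw [mul_assoc, mul_assoc, ← mul_pow, ← mul_pow]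
        congr 2
        field_simp
    · rintro ⟨⟨m1, m2⟩, X1, X2⟩ hb
      simp only [mem_filter, mem_product, mem_Bx] at hb
      obtain ⟨⟨-, ⟨b1, b2⟩, b3, b4⟩, -⟩ := hb
      refine le_trans ?_ (Nat.mul_le_mul (ht X1 b1 b2) (ht X2 b3 b4))
      rw [← card_product]
      apply Finset.card_le_card_of_injOn
        (fun w : (_ : ZMod p) × ((ℤ × ℤ) × (ℤ × ℤ)) =>
          ((w.2.2.1, w.2.1.2), (w.2.1.1, w.2.2.2)))
      · rintro ⟨m, ⟨x1, x2⟩, y1, y2⟩ hw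
        simp only [coe_filter, Set.mem_ofPred_eq, mem_sigma, mem_product, D, A2, mem_filter,
          Prod.mk.injEq] at hw
        obtain ⟨⟨a0, ⟨⟨a1, a2⟩, a3⟩, ⟨a4, a5⟩, a6⟩, -, c1, c2⟩ := hw
        simp only [coe_product, Set.mem_prod, coe_filter, Set.mem_ofPred_eq, mem_product]
        exact ⟨⟨⟨a4, a2⟩, c1⟩, ⟨a1, a5⟩, c2⟩
      · rintro ⟨m, ⟨x1, x2⟩, y1, y2⟩ hw ⟨m', ⟨x1', x2'⟩, y1', y2'⟩ hw' h
        simp only [coe_filter, Set.mem_ofPred_eq, mem_sigma, mem_product, D, A2, mem_filter,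
          Prod.mk.injEq] at hw hw' h
        obtain ⟨⟨rfl, rfl⟩, rfl, rfl⟩ := h
        obtain ⟨⟨a0, ⟨⟨a1, a2⟩, a3⟩, ⟨a4, a5⟩, a6⟩, ⟨d1, d2⟩, c1, c2⟩ := hw
        obtain ⟨-, ⟨d1', d2'⟩, -⟩ := hw'
        have n2 := hne x2 a2
        have n1 := hne x1 a1
        have e : m = m' := by
          apply mul_right_cancel₀ (pow_ne_zero k (div_ne_zero n1 n2))
          rw [d1, d1']
        rw [e]
  calc JJ k M (Bx n) ^ 2 ≤ (∑ m ∈ M, (D m).card) ^ 2 := Nat.pow_le_pow_left h1 2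
    _ ≤ M.card * ∑ m ∈ M, (D m).card ^ 2 := sq_sum_le_card_mul_sum_sq
    _ ≤ _ := Nat.mul_le_mul_left _ h2

noncomputable def SS {p : ℕ} [Fact p.Prime] (k : ℕ) (M : Finset (ZMod p)) : ℝ :=
  ∑ l : ZMod p, (RR k M l : ℝ) / (rho l : ℝ)

lemma JJ_le {p : ℕ} [hp : Fact p.Prime] (k : ℕ) (hk : 1 ≤ k) (M : Finset (ZMod p))
    (hM : ∀ m ∈ M, m ≠ 0) (A : Finset ℤ)
    (hA : ∀ x ∈ A, (x : ZMod p) ≠ 0) (a : ℤ) (h : ℕ) (hAI : A ⊆ Icc a (a + h)) :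
    (JJ k M A : ℝ) ≤ 4 * k * ((h:ℝ)^2 * (M.card:ℝ)^2 / p) + 10 * h * SS k M
      + 4 * k * (M.card:ℝ)^2 := by
  rw [JJ_eq k M A hA]
  push_cast
  have hs : (∑ l : ZMod p, (RR k M l : ℝ)) ≤ k * (M.card:ℝ)^2 := by
    exact_mod_cast sum_RR k hk M hM
  have hpp : (0:ℝ) < p := by exact_mod_cast hp.out.pos
  calc _ ≤ ∑ l : ZMod p, (RR k M l : ℝ) * (4 * (h:ℝ)^2 / p + 10 * h / rho l + 4) := by
        apply Finset.sum_le_sum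
        intro l _
        exact mul_le_mul_of_nonneg_left (NN_le hp.out l a h A hAI) (by positivity)
    _ = (4 * (h:ℝ)^2 / p + 4) * (∑ l : ZMod p, (RR k M l : ℝ)) + 10 * h * SS k M := by
        unfold SS
        rw [Finset.mul_sum, Finset.mul_sum, ← Finset.sum_add_distrib]
        apply Finset.sum_congr rfl
        intro l _
        ring
    _ ≤ (4 * (h:ℝ)^2 / p + 4) * (k * (M.card:ℝ)^2) + 10 * h * SS k M := by
        gcongr
    _ = _ := by ring

lemma inv_le_sum (r : ℕ) (hr : 1 ≤ r) (N : ℕ) : 1 / (r:ℝ) ≤ 1 / ((N:ℝ) + 1) +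
    ∑ n ∈ Icc 1 N, (if r ≤ n then (1:ℝ) else 0) / ((n:ℝ) * (n + 1)) := by
  have hr' : (1:ℝ) ≤ r := by exact_mod_cast hr
  induction N with
  | zero => simp; exact inv_le_one_of_one_le₀ hr'
  | succ N ih =>
    by_cases h : r ≤ N + 1
    · rw [Finset.sum_Icc_succ_top (by omega), if_pos h]
      push_cast
      have : 1 / ((N:ℝ) + 1) = 1 / ((N:ℝ) + 1 + 1) + 1 / (((N:ℝ) + 1) * (N + 1 + 1)) := by
        field_simp
      linarith
    · have h1 : 0 ≤ ∑ n ∈ Icc 1 (N+1), (if r ≤ n then (1:ℝ) else 0) / ((n:ℝ) * (n + 1)) := by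
        apply Finset.sum_nonneg
        intro i _
        split_ifs <;> positivity
      have h2 : ((N + 1 : ℕ) : ℝ) + 1 ≤ r := by
        have : N + 1 + 1 ≤ r := by omega
        exact_mod_cast this
      have h3 : 1 / (r:ℝ) ≤ 1 / (((N + 1 : ℕ) : ℝ) + 1) :=
        one_div_le_one_div_of_le (by positivity) h2
      linarith

lemma SS_le {p : ℕ} [hp : Fact p.Prime] (k : ℕ) (hk : 1 ≤ k) (M : Finset (ZMod p))
    (hM : ∀ m ∈ M, m ≠ 0) (N : ℕ) (hN : N < p) :
    SS k M ≤ k * (M.card:ℝ)^2 / ((N:ℝ) + 1) +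
      ∑ n ∈ Icc 1 N, (JJ k M (Bx n) : ℝ) / ((n:ℝ) * (n + 1)) := by
  have hs : (∑ l : ZMod p, (RR k M l : ℝ)) ≤ k * (M.card:ℝ)^2 := by
    exact_mod_cast sum_RR k hk M hM
  calc SS k M ≤ ∑ l : ZMod p, (RR k M l : ℝ) * (1 / ((N:ℝ) + 1) +
        ∑ n ∈ Icc 1 N, (if rho l ≤ n then (1:ℝ) else 0) / ((n:ℝ) * (n + 1))) := by
        unfold SS
        apply Finset.sum_le_sum
        intro l _
        rw [div_eq_mul_one_div]
        exact mul_le_mul_of_nonneg_left (inv_le_sum _ (rho_pos hp.out l) N) (by positivity)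
    _ = (∑ l : ZMod p, (RR k M l : ℝ)) / ((N:ℝ) + 1) + ∑ n ∈ Icc 1 N,
        (∑ l : ZMod p, (RR k M l : ℝ) * (if rho l ≤ n then (1:ℝ) else 0)) / ((n:ℝ) * (n + 1)) := by
        simp_rw [mul_add, Finset.sum_add_distrib, Finset.mul_sum, Finset.sum_div]
        congr 1
        · apply Finset.sum_congr rfl; intros; ring
        · rw [Finset.sum_comm]
          apply Finset.sum_congr rfl; intros
          apply Finset.sum_congr rfl; intros; ring
    _ ≤ _ := by
        apply add_le_add
        · gcongr
        · apply Finset.sum_le_sum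
          intro n hn
          rw [mem_Icc] at hn
          have hnp : n < p := by omega
          apply div_le_div_of_nonneg_right _ (by positivity)
          rw [JJ_eq k M _ (Bx_ne hnp)]
          push_cast
          apply Finset.sum_le_sum
          intro l _
          split_ifs with h
          · by_cases hl : l = 0
            · rw [hl, RR_zero k hk M hM]; simp
            · apply mul_le_mul_of_nonneg_left _ (by positivity)
              exact_mod_cast NN_pos hp.out l hl n hnp h
          · rw [mul_zero]; positivity

lemma quad_bound (A X B : ℝ) (hA : 1 ≤ A) (hX : 1 ≤ X) (h : B ^ 2 ≤ A * (X ^ 2 + B)) :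
    B ≤ 2 * A * X := by
  by_contra hc
  push Not at hc
  have hAX : A ≤ A * X := le_mul_of_one_le_right (by linarith) hX
  have hXA : X ≤ A * X := le_mul_of_one_le_left (by linarith) hA
  have hB : 0 < B := by nlinarith
  nlinarith [mul_pos hB hB, mul_nonneg (sub_nonneg.2 hA) (sq_nonneg X)]

lemma harm_sum (N : ℕ) (δ : ℝ) (hδ : 0 < δ) (p : ℕ) (hp : 1 ≤ p) (hN : N ≤ p) :
    ∑ n ∈ Icc 1 N, (1:ℝ) / ((n:ℝ) + 1) ≤ (1 + 1 / δ) * (p:ℝ) ^ δ := by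
  have hpr : (1:ℝ) ≤ p := by exact_mod_cast hp
  have h1 : ∑ n ∈ Icc 1 N, (1:ℝ) / ((n:ℝ) + 1) ≤ (harmonic N : ℝ) := by
    rw [harmonic_eq_sum_Icc]
    push_cast
    apply Finset.sum_le_sum
    intro n hn
    rw [mem_Icc] at hn
    have : (0:ℝ) < n := by exact_mod_cast hn.1
    rw [← one_div]
    exact one_div_le_one_div_of_le this (by linarith)
  have h2 := harmonic_le_one_add_log N
  have h3 : Real.log N ≤ Real.log p := by
    rcases Nat.eq_zero_or_pos N with h | h
    · rw [h]; simp; exact Real.log_nonneg hpr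
    · exact Real.log_le_log (by exact_mod_cast h) (by exact_mod_cast hN)
  have h4 := Real.log_le_rpow_div (x := p) (by positivity) hδ
  have h5 : (1:ℝ) ≤ (p:ℝ) ^ δ := Real.one_le_rpow hpr hδ.le
  have : (1 + 1 / δ) * (p:ℝ) ^ δ = (p:ℝ) ^ δ + (p:ℝ) ^ δ / δ := by ring
  linarith

set_option maxHeartbeats 1000000 in
lemma SS_main (k : ℕ) (hk : 1 ≤ k) (δ : ℝ) (hδ : 0 < δ) : ∃ C : ℝ, 0 < C ∧
    ∀ (p : ℕ) [Fact p.Prime] (M : Finset (ZMod p)), (∀ m ∈ M, m ≠ 0) →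
    ∀ X : ℝ, 1 ≤ X → X ≤ (M.card : ℝ) → (M.card : ℝ) ^ 3 / p ≤ X ^ 4 →
    SS k M ≤ C * ((M.card : ℝ) * X * (p:ℝ) ^ δ) := by
  have hd : 0 < δ / 4 := by positivity
  obtain ⟨C1, hC1, hdiv⟩ := aux_div (δ / 4) hd
  set ch : ℝ := 1 + 1 / (δ / 4) with hch
  have hch1 : 1 ≤ ch := by
    have : 0 < 1 / (δ / 4) := by positivity
    linarith
  have hk' : (1:ℝ) ≤ k := by exact_mod_cast hk
  refine ⟨k + 320 * k * C1 ^ 2 * ch ^ 2, by positivity, ?_⟩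
  intro p hp M hM X hX1 hXm hX4
  set m : ℝ := (M.card : ℝ) with hm
  set P : ℝ := (p:ℝ) ^ (δ / 4) with hP
  have hpr : (1:ℝ) ≤ p := by exact_mod_cast hp.out.one_lt.le
  have hp0 : (0:ℝ) < p := by linarith
  have hP1 : 1 ≤ P := Real.one_le_rpow hpr hd.le
  have hm1 : 1 ≤ m := hX1.trans hXm
  have hX0 : 0 < X := by linarith
  have hmp : m < p := by
    have : M.card < p := by
      calc M.card < (Finset.univ : Finset (ZMod p)).card := by
            apply Finset.card_lt_card
            rw [Finset.ssubset_univ_iff]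
            intro h
            exact hM 0 (by rw [h]; simp) rfl
        _ = p := by rw [Finset.card_univ, ZMod.card]
    rw [hm]; exact_mod_cast this
  set N : ℕ := ⌊m / X⌋₊ with hN
  have hNle : (N:ℝ) ≤ m / X := Nat.floor_le (by positivity)
  have hNlt : m / X < N + 1 := Nat.lt_floor_add_one _
  have hN1 : 1 ≤ N := by
    rw [hN, Nat.one_le_floor_iff, one_le_div hX0]; exact hXm
  have hsmall : ∀ n : ℕ, n ≤ N → n * n < p := by
    intro n hn
    have h1 : (n:ℝ) * X ≤ m := by
      rw [← le_div_iff₀ hX0]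
      exact le_trans (by exact_mod_cast hn) hNle
    have h2 : ((n:ℝ) * n) ^ 2 < (p:ℝ) ^ 2 := by
      have e1 : ((n:ℝ) * X) ^ 4 ≤ m ^ 4 := pow_le_pow_left₀ (by positivity) h1 4
      rw [div_le_iff₀ hp0] at hX4
      have e2 : m ^ 4 ≤ (m * p) * X ^ 4 := by nlinarith
      have e3 : ((n:ℝ) * n) ^ 2 * X ^ 4 ≤ (m * p) * X ^ 4 := by
        calc _ = ((n:ℝ) * X) ^ 4 := by ring
          _ ≤ _ := e1.trans e2
      have e4 := le_of_mul_le_mul_right e3 (by positivity)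
      nlinarith
    have := lt_of_pow_lt_pow_left₀ 2 hp0.le h2
    exact_mod_cast this
  have hNp : N < p := lt_of_le_of_lt (Nat.le_mul_self N) (hsmall N le_rfl)
  obtain ⟨n0, hn0, hmax⟩ := Finset.exists_max_image (Icc 1 N)
    (fun n => (JJ k M (Bx n) : ℝ) / (n * m)) ⟨1, by simp [hN1]⟩
  rw [mem_Icc] at hn0
  set B : ℝ := (JJ k M (Bx n0) : ℝ) / (n0 * m) with hB
  have hn0r : (1:ℝ) ≤ n0 := by exact_mod_cast hn0.1
  have hB0 : 0 ≤ B := by positivity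
  have hJB : ∀ n : ℕ, 1 ≤ n → n ≤ N → (JJ k M (Bx n) : ℝ) ≤ B * (n * m) := by
    intro n h1 h2
    have := hmax n (by rw [mem_Icc]; exact ⟨h1, h2⟩)
    have hn : (0:ℝ) < n := by exact_mod_cast h1
    rwa [div_le_iff₀ (by positivity)] at this
  -- bound for S
  have hS : SS k M ≤ m * (k * X + B * (ch * P)) := by
    refine (SS_le k hk M hM N hNp).trans ?_
    have s1 : k * m ^ 2 / ((N:ℝ) + 1) ≤ m * (k * X) := by
      rw [div_le_iff₀ (by positivity)]
      rw [div_lt_iff₀ hX0] at hNlt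
      have : k * m * m ≤ k * m * ((N + 1) * X) := by gcongr
      nlinarith
    have s2 : ∑ n ∈ Icc 1 N, (JJ k M (Bx n) : ℝ) / ((n:ℝ) * (n + 1)) ≤
        m * (B * (ch * P)) := by
      calc _ ≤ ∑ n ∈ Icc 1 N, (m * B) * ((1:ℝ) / ((n:ℝ) + 1)) := by
            apply Finset.sum_le_sum
            intro n hn
            rw [mem_Icc] at hn
            have hn' : (0:ℝ) < n := by exact_mod_cast hn.1
            rw [div_le_iff₀ (by positivity)]
            refine (hJB n hn.1 hn.2).trans (le_of_eq ?_)
            field_simp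
        _ = (m * B) * ∑ n ∈ Icc 1 N, ((1:ℝ) / ((n:ℝ) + 1)) := by rw [Finset.mul_sum]
        _ ≤ (m * B) * (ch * P) := by
            apply mul_le_mul_of_nonneg_left _ (by positivity)
            exact harm_sum N (δ / 4) hd p hp.out.one_lt.le hNp.le
        _ = _ := by ring
    linarith
  -- Cauchy
  set t : ℕ := ⌊2 * (C1 * P)⌋₊ with ht
  have htle : (t:ℝ) ≤ 2 * (C1 * P) := Nat.floor_le (by positivity)
  have hsq := JJ_sq k M n0 t (hsmall n0 hn0.2) (by
    intro U hU hUle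
    refine (fact_count n0 U hU).trans ?_
    rw [ht, Nat.le_floor_iff (by positivity)]
    push_cast
    have h1 := hdiv U.natAbs (by simpa using hU)
    have h2 : ((U.natAbs : ℕ) : ℝ) ≤ p := by
      have : U.natAbs ≤ p := by
        have := hsmall n0 hn0.2
        rw [Int.abs_eq_natAbs] at hUle
        omega
      exact_mod_cast this
    have h3 : ((U.natAbs : ℕ) : ℝ) ^ (δ / 4) ≤ P := Real.rpow_le_rpow (by positivity) h2 hd.le
    have h4 : C1 * ((U.natAbs : ℕ) : ℝ) ^ (δ / 4) ≤ C1 * P := by gcongr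
    linarith)
  have hsqR : (B * (n0 * m)) ^ 2 ≤ m * ((2 * (C1 * P)) ^ 2 * (JJ k M (Bx (n0 * n0)) : ℝ)) := by
    have e : B * (n0 * m) = (JJ k M (Bx n0) : ℝ) := by rw [hB]; field_simp
    rw [e]
    calc ((JJ k M (Bx n0) : ℝ)) ^ 2 ≤ m * ((t:ℝ) * t * (JJ k M (Bx (n0 * n0)) : ℝ)) := by
          rw [hm]; exact_mod_cast hsq
      _ ≤ _ := by
          rw [← sq]; gcongr
  have hJ2 : (JJ k M (Bx (n0 * n0)) : ℝ) ≤ (n0:ℝ)^2 * m * (40 * k * X ^ 2 + 20 * B * (ch * P)) := by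
    have hchP : 1 ≤ ch * P := one_le_mul_of_one_le_of_one_le hch1 hP1
    by_cases hc : n0 * n0 ≤ N
    · refine (hJB (n0 * n0) (Nat.mul_pos hn0.1 hn0.1) hc).trans ?_
      push_cast
      have : B ≤ 40 * k * X ^ 2 + 20 * B * (ch * P) := by
        have : 0 ≤ 40 * k * X ^ 2 := by positivity
        have := mul_le_mul_of_nonneg_left hchP hB0
        linarith
      calc B * ((n0:ℝ) * n0 * m) = (n0:ℝ)^2 * m * B := by ring
        _ ≤ _ := by gcongr
    · have hge : m / X ≤ (n0:ℝ)^2 := by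
        have : N + 1 ≤ n0 * n0 := by omega
        have : (N:ℝ) + 1 ≤ (n0:ℝ) * n0 := by exact_mod_cast this
        rw [sq]; linarith
      have h0 := JJ_le k hk M hM (Bx (n0 * n0)) (Bx_ne (hsmall n0 hn0.2))
        (-((n0 * n0 : ℕ) : ℤ)) (2 * (n0 * n0)) (by
          intro x hx
          rw [mem_Bx, abs_le] at hx
          rw [mem_Icc]
          push_cast at hx ⊢
          constructor <;> linarith)
      refine h0.trans ?_
      push_cast
      rw [← hm]
      have k1 : m ≤ (n0:ℝ)^2 * X := by rwa [div_le_iff₀ hX0] at hge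
      have k2 : (n0:ℝ) * X ≤ m := by
        rw [← le_div_iff₀ hX0]
        exact le_trans (by exact_mod_cast hn0.2) hNle
      have k3 : (n0:ℝ)^2 * m / p ≤ X ^ 2 := by
        have e1 : ((n0:ℝ) * X)^2 ≤ m ^ 2 := pow_le_pow_left₀ (by positivity) k2 2
        rw [div_le_iff₀ hp0] at hX4 ⊢
        have e2 : (n0:ℝ)^2 * m * X ^ 2 ≤ X ^ 2 * p * X ^ 2 := by
          calc (n0:ℝ)^2 * m * X ^ 2 = ((n0:ℝ) * X)^2 * m := by ring
            _ ≤ m ^ 2 * m := by gcongr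
            _ = m ^ 3 := by ring
            _ ≤ X ^ 4 * p := hX4
            _ = _ := by ring
        exact le_of_mul_le_mul_right e2 (by positivity)
      have k4 : 4 * k * ((2 * ((n0:ℝ) * n0))^2 * m^2 / p) ≤ (n0:ℝ)^2 * m * (16 * k * X ^ 2) := by
        calc 4 * k * ((2 * ((n0:ℝ) * n0))^2 * m^2 / p)
            = (n0:ℝ)^2 * m * (16 * k * ((n0:ℝ)^2 * m / p)) := by ring
          _ ≤ _ := by gcongr
      have hXX : X ≤ X ^ 2 := by nlinarith
      have k5 : 4 * k * m ^ 2 ≤ (n0:ℝ)^2 * m * (4 * k * X ^ 2) := by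
        calc 4 * k * m ^ 2 = 4 * k * m * m := by ring
          _ ≤ 4 * k * m * ((n0:ℝ)^2 * X) := by gcongr
          _ ≤ 4 * k * m * ((n0:ℝ)^2 * X ^ 2) := by gcongr
          _ = _ := by ring
      have k6 : 10 * (2 * ((n0:ℝ) * n0)) * SS k M ≤
          (n0:ℝ)^2 * m * (20 * k * X ^ 2 + 20 * B * (ch * P)) := by
        calc 10 * (2 * ((n0:ℝ) * n0)) * SS k M
            ≤ 10 * (2 * ((n0:ℝ) * n0)) * (m * (k * X + B * (ch * P))) := by gcongr
          _ = (n0:ℝ)^2 * m * (20 * k * X + 20 * B * (ch * P)) := by ring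
          _ ≤ _ := by gcongr
      calc _ ≤ (n0:ℝ)^2 * m * (16 * k * X ^ 2) +
            (n0:ℝ)^2 * m * (20 * k * X ^ 2 + 20 * B * (ch * P)) +
            (n0:ℝ)^2 * m * (4 * k * X ^ 2) := by linarith
        _ = _ := by ring
  have hB2 : B ^ 2 ≤ (160 * k * C1 ^ 2 * P ^ 2 * (ch * P)) * (X ^ 2 + B) := by
    have hchP : 1 ≤ ch * P := one_le_mul_of_one_le_of_one_le hch1 hP1
    have e1 : (((n0:ℝ) * m) ^ 2) * B ^ 2 ≤ (((n0:ℝ) * m) ^ 2) *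
        ((2 * (C1 * P)) ^ 2 * (40 * k * X ^ 2 + 20 * B * (ch * P))) := by
      calc (((n0:ℝ) * m) ^ 2) * B ^ 2 = (B * (n0 * m)) ^ 2 := by ring
        _ ≤ _ := hsqR
        _ ≤ m * ((2 * (C1 * P)) ^ 2 *
            ((n0:ℝ)^2 * m * (40 * k * X ^ 2 + 20 * B * (ch * P)))) := by gcongr
        _ = _ := by ring
    have e2 := le_of_mul_le_mul_left e1 (by positivity)
    refine e2.trans ?_
    have e3 : 40 * k * X ^ 2 + 20 * B * (ch * P) ≤ 40 * k * (ch * P) * (X ^ 2 + B) := by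
      have f1 : 40 * k * X ^ 2 ≤ 40 * k * X ^ 2 * (ch * P) :=
        le_mul_of_one_le_right (by positivity) hchP
      have f2 : 20 * B * (ch * P) ≤ 20 * B * (ch * P) * k :=
        le_mul_of_one_le_right (by positivity) hk'
      have f3 : 0 ≤ 20 * B * (ch * P) * k := by positivity
      nlinarith
    calc _ ≤ (2 * (C1 * P)) ^ 2 * (40 * k * (ch * P) * (X ^ 2 + B)) := by gcongr
      _ = _ := by ring
  have hBX := quad_bound _ X B (by
    have hchP : 1 ≤ ch * P := one_le_mul_of_one_le_of_one_le hch1 hP1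
    have : 1 ≤ C1 ^ 2 := one_le_pow₀ hC1
    have : 1 ≤ P ^ 2 := one_le_pow₀ hP1
    have h160 : (1:ℝ) ≤ 160 * k := by linarith
    exact one_le_mul_of_one_le_of_one_le (one_le_mul_of_one_le_of_one_le
      (one_le_mul_of_one_le_of_one_le h160 ‹_›) ‹_›) hchP) hX1 hB2
  have hPd : P ^ 4 = (p:ℝ) ^ δ := by
    rw [hP, ← Real.rpow_natCast, ← Real.rpow_mul hp0.le]
    congr 1; push_cast; ring
  rw [← hPd]
  calc SS k M ≤ m * (k * X + B * (ch * P)) := hS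
    _ ≤ m * (k * X + (2 * (160 * k * C1 ^ 2 * P ^ 2 * (ch * P)) * X) * (ch * P)) := by gcongr
    _ = m * X * (k + 320 * k * C1 ^ 2 * ch ^ 2 * P ^ 4) := by ring
    _ ≤ m * X * (k * P ^ 4 + 320 * k * C1 ^ 2 * ch ^ 2 * P ^ 4) := by
        have : (1:ℝ) ≤ P ^ 4 := one_le_pow₀ hP1
        gcongr
        exact le_mul_of_one_le_right (by positivity) this
    _ = _ := by ring

lemma JJ_main (k : ℕ) (hk : 1 ≤ k) (δ : ℝ) (hδ : 0 < δ) : ∃ C : ℝ, 0 < C ∧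
    ∀ (p : ℕ) [Fact p.Prime] (L H : ℤ), 1 ≤ H →
    (∀ x ∈ Finset.Icc (L + 1) (L + H), 1 ≤ x ∧ x ≤ (p : ℤ) - 1) →
    ∀ (M : Finset (ZMod p)), (∀ m ∈ M, m ≠ 0) →
    ∀ X : ℝ, 1 ≤ X → X ≤ (M.card : ℝ) → (M.card : ℝ) ^ 3 / p ≤ X ^ 4 →
    (JJ k M (Icc (L + 1) (L + H)) : ℝ) ≤ C * ((H:ℝ)^2 * (M.card : ℝ)^2 / p +
      (H:ℝ) * (M.card : ℝ) * (X * (p:ℝ) ^ δ) + (M.card : ℝ)^2) := by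
  obtain ⟨C0, hC0, h0⟩ := SS_main k hk δ hδ
  refine ⟨4 * k + 10 * C0, by positivity, ?_⟩
  intro p hp L H hH hI M hM X h1 h2 h3
  have hS := h0 p M hM X h1 h2 h3
  obtain ⟨h, rfl⟩ := Int.eq_ofNat_of_zero_le (by omega : 0 ≤ H)
  have hJ := JJ_le k hk M hM (Icc (L + 1) (L + h)) (by
    intro x hx
    have := hI x hx
    exact cast_ne_zero_of_abs_lt (by omega) (by rw [abs_lt]; omega)) (L + 1) h (by
    apply Finset.Icc_subset_Icc le_rfl; omega)
  refine hJ.trans ?_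
  push_cast
  have hp0 : (0:ℝ) < p := by exact_mod_cast hp.out.pos
  set a := (h:ℝ)^2 * (M.card : ℝ)^2 / p
  set b := (h:ℝ) * (M.card : ℝ) * (X * (p:ℝ) ^ δ) with hb
  have ha0 : 0 ≤ a := by positivity
  have hb0 : 0 ≤ b := by positivity
  have hc0 : 0 ≤ (M.card:ℝ)^2 := by positivity
  have : 10 * h * SS k M ≤ 10 * C0 * b := by
    calc 10 * h * SS k M ≤ 10 * h * (C0 * ((M.card : ℝ) * X * (p:ℝ) ^ δ)) := by gcongr
      _ = _ := by rw [hb]; ring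
  nlinarith [mul_nonneg hC0.le ha0, mul_nonneg hC0.le hc0, mul_nonneg (Nat.cast_nonneg (α := ℝ) k) hb0]

lemma JJ_empty {p : ℕ} (k : ℕ) (A : Finset ℤ) : JJ k (∅ : Finset (ZMod p)) A = 0 := by
  simp [JJ]

lemma count_le_JJ {p : ℕ} [Fact p.Prime] (s : ℤ) (M : Finset (ZMod p)) (A : Finset ℤ)
    (hA : ∀ x ∈ A, (x : ZMod p) ≠ 0) :
    (((M ×ˢ M) ×ˢ (A ×ˢ A)).filter
            (fun q => q.1.1 * (if 0 ≤ s then (((q.2.1 : ZMod p)) ^ s.toNat)⁻¹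
                               else ((q.2.1 : ZMod p)) ^ (-s).toNat)
                    = q.1.2 * (if 0 ≤ s then (((q.2.2 : ZMod p)) ^ s.toNat)⁻¹
                               else ((q.2.2 : ZMod p)) ^ (-s).toNat))).card ≤
    JJ s.natAbs M A := by
  unfold JJ
  by_cases hs : 0 ≤ s
  · have e : s.toNat = s.natAbs := by omega
    simp only [if_pos hs, e]
    apply Finset.card_le_card_of_injOn (fun q => (q.1, (q.2.2, q.2.1)))
    · rintro ⟨⟨m1, m2⟩, x1, x2⟩ hq
      simp only [coe_filter, Set.mem_ofPred_eq, mem_product] at hq ⊢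
      obtain ⟨⟨⟨a1, a2⟩, a3, a4⟩, a5⟩ := hq
      have n1 := pow_ne_zero s.natAbs (hA _ a3)
      have n2 := pow_ne_zero s.natAbs (hA _ a4)
      refine ⟨⟨⟨a1, a2⟩, a4, a3⟩, ?_⟩
      rw [← div_eq_mul_inv, ← div_eq_mul_inv, div_eq_div_iff n1 n2] at a5
      exact a5
    · rintro ⟨⟨m1, m2⟩, x1, x2⟩ _ ⟨⟨m1', m2'⟩, x1', x2'⟩ _ h
      simp only [Prod.mk.injEq] at h ⊢
      tauto
  · have e : (-s).toNat = s.natAbs := by omega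
    simp only [if_neg hs, e]
    exact le_rfl

lemma case_one {m p H ε : ℝ} (hε : 0 < ε) (hp : 1 ≤ p) (hm : 1 ≤ m) (hH : p ^ ((2:ℝ)/3) ≤ H)
    {y : ℝ} (hy0 : 0 ≤ y) (hy : y ^ 4 = m ^ 3 / p) :
    y * p ^ (ε / 4) ≤ H * m / p + p ^ ε := by
  have hp0 : 0 < p := by linarith
  set a := p ^ (ε / 4) with ha
  have ha1 : 1 ≤ a := Real.one_le_rpow hp (by positivity)
  have ha4 : a ^ 4 = p ^ ε := by
    rw [ha, ← Real.rpow_natCast, ← Real.rpow_mul hp0.le]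
    congr 1; push_cast; ring
  have hH0 : 0 < H := lt_of_lt_of_le (by positivity) hH
  rw [← ha4]
  by_cases h : y ≤ a ^ 3
  · have : y * a ≤ a ^ 3 * a := by gcongr
    have : 0 ≤ H * m / p := by positivity
    nlinarith
  · push Not at h
    set w := p ^ ((2:ℝ)/3) with hw
    have hw3 : w ^ 3 = p ^ 2 := by
      rw [hw, ← Real.rpow_natCast, ← Real.rpow_mul hp0.le, ← Real.rpow_natCast]
      congr 1; norm_num
    have h1 : (y * a) ^ 3 ≤ (w * m / p) ^ 3 := by
      calc (y * a) ^ 3 = y ^ 3 * a ^ 3 := by ring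
        _ ≤ y ^ 3 * y := by gcongr
        _ = y ^ 4 := by ring
        _ = m ^ 3 / p := hy
        _ = w ^ 3 * m ^ 3 / p ^ 3 := by rw [hw3]; field_simp
        _ = _ := by ring
    have h2 : y * a ≤ w * m / p := le_of_pow_le_pow_left₀ (by norm_num) (by positivity) h1
    have h3 : w * m / p ≤ H * m / p := by gcongr
    have : 0 < a ^ 4 := by positivity
    linarith

/-- Lemma 2.5: bounds for the number of solutions of
m₁x₁^{-s} ≡ m₂x₂^{-s} (mod p), for a nonzero integer s, with m₁, m₂ ∈ 𝓜 and
x₁, x₂ ∈ {L+1,…,L+H}. Here x^{-s} means (x^s)⁻¹ when s ≥ 0 and x^{|s|} when s < 0. -/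
theorem stmt_8 (s : ℤ) (hs : s ≠ 0) :
    ∀ ε : ℝ, 0 < ε → ∃ C : ℝ, 0 < C ∧
      ∀ (p : ℕ), p.Prime → ∀ (L H : ℤ), 1 ≤ H →
      (∀ x ∈ Finset.Icc (L + 1) (L + H), 1 ≤ x ∧ x ≤ (p : ℤ) - 1) →
      ∀ (M : Finset (ZMod p)), (∀ m ∈ M, m ≠ 0) →
      (((p : ℝ) ^ ((2:ℝ)/3) ≤ (H : ℝ) →
        ((((M ×ˢ M) ×ˢ (Finset.Icc (L + 1) (L + H) ×ˢ Finset.Icc (L + 1) (L + H))).filter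
            (fun q => q.1.1 * (if 0 ≤ s then (((q.2.1 : ZMod p)) ^ s.toNat)⁻¹
                               else ((q.2.1 : ZMod p)) ^ (-s).toNat)
                    = q.1.2 * (if 0 ≤ s then (((q.2.2 : ZMod p)) ^ s.toNat)⁻¹
                               else ((q.2.2 : ZMod p)) ^ (-s).toNat))).card : ℝ) ≤
          C * ((H : ℝ) ^ 2 * (M.card : ℝ) ^ 2 / (p : ℝ)
            + (H : ℝ) * (M.card : ℝ) * (p : ℝ) ^ ε)) ∧
       ((H : ℝ) < (p : ℝ) ^ ((2:ℝ)/3) → (p : ℝ) ^ ((1:ℝ)/3) ≤ (M.card : ℝ) →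
        ((((M ×ˢ M) ×ˢ (Finset.Icc (L + 1) (L + H) ×ˢ Finset.Icc (L + 1) (L + H))).filter
            (fun q => q.1.1 * (if 0 ≤ s then (((q.2.1 : ZMod p)) ^ s.toNat)⁻¹
                               else ((q.2.1 : ZMod p)) ^ (-s).toNat)
                    = q.1.2 * (if 0 ≤ s then (((q.2.2 : ZMod p)) ^ s.toNat)⁻¹
                               else ((q.2.2 : ZMod p)) ^ (-s).toNat))).card : ℝ) ≤
          C * ((H : ℝ) ^ 2 * (M.card : ℝ) ^ 2 / (p : ℝ)
            + (H : ℝ) * (M.card : ℝ) ^ ((7:ℝ)/4) * (p : ℝ) ^ (-(1:ℝ)/4 + ε)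
            + (M.card : ℝ) ^ 2)) ∧
       ((H : ℝ) < (p : ℝ) ^ ((2:ℝ)/3) → (M.card : ℝ) < (p : ℝ) ^ ((1:ℝ)/3) →
        ((((M ×ˢ M) ×ˢ (Finset.Icc (L + 1) (L + H) ×ˢ Finset.Icc (L + 1) (L + H))).filter
            (fun q => q.1.1 * (if 0 ≤ s then (((q.2.1 : ZMod p)) ^ s.toNat)⁻¹
                               else ((q.2.1 : ZMod p)) ^ (-s).toNat)
                    = q.1.2 * (if 0 ≤ s then (((q.2.2 : ZMod p)) ^ s.toNat)⁻¹
                               else ((q.2.2 : ZMod p)) ^ (-s).toNat))).card : ℝ) ≤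
          C * ((H : ℝ) * (M.card : ℝ) * (p : ℝ) ^ ε + (M.card : ℝ) ^ 2))) := by
  have hk : 1 ≤ s.natAbs := by omega
  intro ε hε
  obtain ⟨C1, hC1, h1⟩ := JJ_main s.natAbs hk (ε / 4) (by positivity)
  obtain ⟨C2, hC2, h2⟩ := JJ_main s.natAbs hk ε hε
  refine ⟨4 * C1 + 2 * C2, by positivity, ?_⟩
  intro p hp L H hH hI M hM
  have := Fact.mk hp
  have hpr : (1:ℝ) ≤ p := by exact_mod_cast hp.one_lt.le
  have hp0 : (0:ℝ) < p := by linarith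
  have hHr : (1:ℝ) ≤ H := by exact_mod_cast hH
  have hJ := count_le_JJ s M (Icc (L + 1) (L + H)) (by
    intro x hx
    have := hI x hx
    exact cast_ne_zero_of_abs_lt (by omega) (by rw [abs_lt]; omega))
  rw [← Nat.cast_le (α := ℝ)] at hJ
  rcases Finset.eq_empty_or_nonempty M with hE | hne
  · have hz : (JJ s.natAbs M (Icc (L + 1) (L + H)) : ℝ) = 0 := by
      rw [hE, JJ_empty]; simp
    rw [hz] at hJ
    refine ⟨fun _ => hJ.trans ?_, fun _ _ => hJ.trans ?_, fun _ _ => hJ.trans ?_⟩ <;> positivity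
  have h1' := h1 p L H hH hI M hM
  have h2' := h2 p L H hH hI M hM
  have hm : (1:ℝ) ≤ M.card := by exact_mod_cast hne.card_pos
  generalize (JJ s.natAbs M (Icc (L + 1) (L + H)) : ℝ) = J at *
  generalize (M.card : ℝ) = m at *
  set y : ℝ := (m ^ 3 / p) ^ ((1:ℝ)/4) with hy
  have hy0 : 0 ≤ y := by positivity
  have hy4 : y ^ 4 = m ^ 3 / p := by
    rw [hy, ← Real.rpow_natCast, ← Real.rpow_mul (by positivity)]
    norm_num
  have hym : y ≤ m := by
    apply le_of_pow_le_pow_left₀ (n := 4) (by norm_num) (by positivity)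
    rw [hy4]
    calc m ^ 3 / p ≤ m ^ 3 := div_le_self (by positivity) hpr
      _ ≤ m ^ 4 := pow_le_pow_right₀ hm (by norm_num)
  have hpe : (1:ℝ) ≤ (p:ℝ) ^ ε := Real.one_le_rpow hpr hε.le
  have hp3 : ((p:ℝ) ^ ((1:ℝ)/3)) ^ 3 = p := by
    rw [← Real.rpow_natCast, ← Real.rpow_mul hp0.le]
    norm_num
  have ha0 : 0 ≤ (H:ℝ)^2 * m ^ 2 / p := by positivity
  refine ⟨fun hc => hJ.trans ?_, fun hc hd => hJ.trans ?_, fun hc hd => hJ.trans ?_⟩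
  · have key : J ≤ C1 * ((H:ℝ)^2 * m^2 / p + (H:ℝ) * m * (H * m / p + (p:ℝ) ^ ε) + m^2) := by
      by_cases hX : m ^ 3 / p ≤ 1
      · refine (h1' 1 le_rfl hm (by simpa using hX)).trans ?_
        have : 1 * (p:ℝ) ^ (ε / 4) ≤ H * m / p + (p:ℝ) ^ ε := by
          have e1 : (p:ℝ) ^ (ε / 4) ≤ (p:ℝ) ^ ε :=
            Real.rpow_le_rpow_of_exponent_le hpr (by linarith)
          have e2 : 0 ≤ H * m / p := by positivity
          linarith
        gcongr
      · push Not at hX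
        have hy1 : 1 ≤ y := Real.one_le_rpow hX.le (by norm_num)
        refine (h1' y hy1 hym hy4.ge).trans ?_
        have := case_one hε hpr hm hc hy0 hy4
        gcongr
    have e1 : m ^ 2 ≤ (H:ℝ)^2 * m ^ 2 / p := by
      rw [le_div_iff₀ hp0, mul_comm]
      gcongr
      have : ((p:ℝ) ^ ((2:ℝ)/3)) ^ 2 ≤ (H:ℝ) ^ 2 := pow_le_pow_left₀ (by positivity) hc 2
      refine le_trans ?_ this
      rw [← Real.rpow_natCast, ← Real.rpow_mul hp0.le]
      calc (p:ℝ) = (p:ℝ) ^ (1:ℝ) := by simp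
        _ ≤ _ := Real.rpow_le_rpow_of_exponent_le hpr (by norm_num)
    have e2 : (H:ℝ) * m * (H * m / p + (p:ℝ) ^ ε) = (H:ℝ)^2 * m^2 / p + H * m * (p:ℝ)^ε := by
      ring
    rw [e2] at key
    have b0 : 0 ≤ H * m * (p:ℝ)^ε := by positivity
    have key2 : J ≤ 4 * C1 * ((H:ℝ)^2 * m^2 / p + H * m * (p:ℝ)^ε) := by
      refine key.trans ?_
      nlinarith
    refine key2.trans ?_
    gcongr
    linarith
  · have hX : 1 ≤ m ^ 3 / p := by
      rw [one_le_div hp0, ← hp3]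
      exact pow_le_pow_left₀ (by positivity) hd 3
    have hy1 : 1 ≤ y := Real.one_le_rpow hX (by norm_num)
    refine (h2' y hy1 hym hy4.ge).trans ?_
    have e : (H:ℝ) * m * (y * (p:ℝ)^ε) = H * m ^ ((7:ℝ)/4) * (p:ℝ) ^ (-(1:ℝ)/4 + ε) := by
      rw [hy, Real.div_rpow (by positivity) hp0.le, Real.rpow_add hp0, ← Real.rpow_natCast m 3,
        ← Real.rpow_mul (by positivity)]
      have f1 : m ^ ((7:ℝ)/4) = m * m ^ (((3:ℕ):ℝ) * (1/4)) := by
        conv_rhs => rw [← Real.rpow_one m, ← Real.rpow_mul (by positivity)]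
        rw [← Real.rpow_add (by linarith)]
        norm_num
      have f2 : (p:ℝ) ^ (-(1:ℝ)/4) = ((p:ℝ) ^ ((1:ℝ)/4))⁻¹ := by
        rw [neg_div, Real.rpow_neg hp0.le]
      rw [f1, f2]
      ring
    rw [e]
    gcongr
    linarith
  · have hX : m ^ 3 / p ≤ 1 := by
      rw [div_le_one hp0, ← hp3]
      exact pow_le_pow_left₀ (by positivity) hd.le 3
    refine (h2' 1 le_rfl hm (by simpa using hX)).trans ?_
    have hHm : H * m ≤ (p:ℝ) := by
      calc H * m ≤ (p:ℝ) ^ ((2:ℝ)/3) * (p:ℝ) ^ ((1:ℝ)/3) := by gcongr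
        _ = p := by rw [← Real.rpow_add hp0]; norm_num
    have e1 : (H:ℝ)^2 * m ^ 2 / p ≤ H * m * (p:ℝ)^ε := by
      rw [div_le_iff₀ hp0]
      calc (H:ℝ)^2 * m ^ 2 = H * m * (H * m) := by ring
        _ ≤ H * m * p := by gcongr
        _ ≤ H * m * (p:ℝ)^ε * p := by
            apply mul_le_mul_of_nonneg_right _ hp0.le
            exact le_mul_of_one_le_right (by positivity) hpe
    have b0 : 0 ≤ H * m * (p:ℝ)^ε := by positivity
    calc _ ≤ 2 * C2 * (H * m * (p:ℝ)^ε + m ^ 2) := by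
          nlinarith [mul_le_mul_of_nonneg_left e1 hC2.le, mul_nonneg hC2.le (sq_nonneg m)]
      _ ≤ _ := by gcongr; linarith
end

section
/- Fix positive integers s and ℓ. For every real ε > 0 there exists C > 0, depending only on s, ℓ and ε, with the following property. Let p be a prime, and let 𝓧 = {L+1, …, L+H} be an interval of H consecutive integers contained in {1, …, p−1} with H ≥ 2. Let J_{ℓ,s}(𝓧) denote the number of 2ℓ-tuples (x_1, …, x_{2ℓ}) ∈ 𝓧^{2ℓ} satisfying x_1^{−s} + ⋯ + x_ℓ^{−s} ≡ x_{ℓ+1}^{−s} + ⋯ + x_{2ℓ}^{−s} (mod p). Then J_{ℓ,s}(𝓧) ≤ C · (H^{2ℓ²/(ℓ+1)} + H^{2ℓ}/p) · H^{ε}. -/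
open Finset

def solCount {ι : Type*} [DecidableEq ι] (p : ℕ) (A : Finset ι) (f : ι → ZMod p) (ℓ : ℕ) : ℕ :=
  (((Fintype.piFinset (fun _ : Fin ℓ => A)) ×ˢ (Fintype.piFinset (fun _ : Fin ℓ => A))).filter
    (fun q => ∑ i, f (q.1 i) = ∑ i, f (q.2 i))).card

lemma map_sum_aux {p ℓ : ℕ} (ψ : AddChar (ZMod p) ℂ) (g : Fin ℓ → ZMod p) :
    ψ (∑ i, g i) = ∏ i, ψ (g i) := by
  have h : ∀ S : Finset (Fin ℓ), ψ (∑ i ∈ S, g i) = ∏ i ∈ S, ψ (g i) := by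
    intro S
    induction S using Finset.induction_on with
    | empty => simp
    | insert a S ha ih => rw [Finset.sum_insert ha, Finset.prod_insert ha, AddChar.map_add_eq_mul, ih]
  exact h _

lemma fourier_count {ι : Type*} [DecidableEq ι] (p : ℕ) [NeZero p] (A : Finset ι)
    (f : ι → ZMod p) (ℓ : ℕ) :
    ∑ ψ : AddChar (ZMod p) ℂ, ‖∑ x ∈ A, ψ (f x)‖ ^ (2 * ℓ) = p * (solCount p A f ℓ : ℝ) := by
  have key : ∀ ψ : AddChar (ZMod p) ℂ, ((‖∑ x ∈ A, ψ (f x)‖ ^ (2 * ℓ) : ℝ) : ℂ) =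
      ∑ q ∈ (Fintype.piFinset (fun _ : Fin ℓ => A)) ×ˢ (Fintype.piFinset (fun _ : Fin ℓ => A)),
        ψ (∑ i, f (q.1 i) - ∑ i, f (q.2 i)) := by
    intro ψ
    have h1 : (∑ x ∈ A, ψ (f x)) ^ ℓ = ∑ q ∈ Fintype.piFinset (fun _ : Fin ℓ => A),
        ψ (∑ i, f (q i)) := by
      rw [Finset.sum_pow']
      refine Finset.sum_congr rfl fun q _ => ?_
      exact (map_sum_aux ψ _).symm
    have h2 : (starRingEnd ℂ) ((∑ x ∈ A, ψ (f x)) ^ ℓ) =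
        ∑ q ∈ Fintype.piFinset (fun _ : Fin ℓ => A), ψ (- ∑ i, f (q i)) := by
      rw [h1, map_sum]
      refine Finset.sum_congr rfl fun q _ => ?_
      rw [AddChar.map_neg_eq_conj]
    rw [pow_mul', Complex.ofReal_pow, ← norm_pow, ← Complex.mul_conj', h2, h1, Finset.sum_mul_sum,
      ← Finset.sum_product']
    refine Finset.sum_congr rfl fun q _ => ?_
    rw [sub_eq_add_neg, AddChar.map_add_eq_mul]
  have h : ((∑ ψ : AddChar (ZMod p) ℂ, ‖∑ x ∈ A, ψ (f x)‖ ^ (2 * ℓ) : ℝ) : ℂ) =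
      ((p * (solCount p A f ℓ : ℝ) : ℝ) : ℂ) := by
    rw [Complex.ofReal_sum, Finset.sum_congr rfl (fun ψ _ => key ψ), Finset.sum_comm]
    simp_rw [AddChar.sum_apply_eq_ite, sub_eq_zero]
    rw [← Finset.sum_filter, Finset.sum_const, solCount]
    simp [ZMod.card, mul_comm]
  exact_mod_cast h

lemma holder_aux {ι : Type*} (I : Finset ι) (a r : ι → ℝ) (ha : ∀ i ∈ I, 0 ≤ a i)
    (hr : ∀ i ∈ I, 0 < r i) (ℓ : ℕ) (hℓ : 0 < ℓ) :
    (∑ i ∈ I, a i) ^ (2 * ℓ) ≤ (I.card : ℝ) ^ (2 * (ℓ - 1)) *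
      ((∑ i ∈ I, r i) * ∑ i ∈ I, a i ^ (2 * ℓ) / r i) := by
  obtain ⟨m, rfl⟩ : ∃ m, ℓ = m + 1 := ⟨ℓ - 1, by omega⟩
  have h1 : (∑ i ∈ I, a i) ^ (m + 1) ≤ (I.card : ℝ) ^ m * ∑ i ∈ I, a i ^ (m + 1) :=
    pow_sum_le_card_mul_sum_pow ha m
  have h2 : (∑ i ∈ I, a i ^ (m + 1)) ^ 2 ≤ (∑ i ∈ I, r i) * ∑ i ∈ I, a i ^ (2 * (m + 1)) / r i := by
    refine Finset.sum_sq_le_sum_mul_sum_of_sq_le_mul I (fun i hi => (hr i hi).le)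
      (fun i hi => div_nonneg (pow_nonneg (ha i hi) _) (hr i hi).le) (fun i hi => le_of_eq ?_)
    have := (hr i hi).ne'
    field_simp
    rw [← pow_mul, mul_comm]
  calc (∑ i ∈ I, a i) ^ (2 * (m + 1)) = ((∑ i ∈ I, a i) ^ (m + 1)) ^ 2 := by rw [← pow_mul]; ring
    _ ≤ ((I.card : ℝ) ^ m * ∑ i ∈ I, a i ^ (m + 1)) ^ 2 := by
        have := pow_nonneg (Finset.sum_nonneg ha) (m + 1)
        gcongr
    _ = (I.card : ℝ) ^ (2 * (m + 1 - 1)) * (∑ i ∈ I, a i ^ (m + 1)) ^ 2 := by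
        rw [mul_pow, ← pow_mul, Nat.add_sub_cancel, mul_comm m 2]
    _ ≤ _ := by gcongr

lemma root_count (p : ℕ) [Fact p.Prime] (s ℓ : ℕ) (hs : 0 < s) (hℓ : ℓ < p) (u v : Fin ℓ → ℕ)
    (hu : ∀ i, u i < p) (hv : ∀ i, v i < p) (w : ℕ)
    (hw : (univ.filter (fun i => u i = w)).card ≠ (univ.filter (fun i => v i = w)).card) :
    (univ.filter (fun b : ZMod p => (∀ i, b + (u i : ZMod p) ≠ 0) ∧ (∀ i, b + (v i : ZMod p) ≠ 0) ∧
      ∑ i, ((b + (u i : ZMod p)) ^ s)⁻¹ = ∑ i, ((b + (v i : ZMod p)) ^ s)⁻¹)).card ≤ 2 * ℓ * s := by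
  classical
  set W : Finset ℕ := univ.image u ∪ univ.image v with hW
  set cu : ℕ → ℕ := fun w => (univ.filter (fun i => u i = w)).card with hcu
  set cv : ℕ → ℕ := fun w => (univ.filter (fun i => v i = w)).card with hcv
  have hWp : ∀ x ∈ W, x < p := by
    intro x hx
    simp only [hW, mem_union, mem_image, mem_univ, true_and] at hx
    rcases hx with ⟨i, rfl⟩ | ⟨i, rfl⟩
    · exact hu i
    · exact hv i
  have hcast : ∀ a < p, ∀ b < p, (a : ZMod p) = b → a = b := by
    intro a ha b hb hab
    rw [ZMod.natCast_eq_natCast_iff'] at hab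
    rwa [Nat.mod_eq_of_lt ha, Nat.mod_eq_of_lt hb] at hab
  have hcule : ∀ x, cu x ≤ ℓ := fun x => (card_le_univ _).trans (by simp)
  have hcvle : ∀ x, cv x ≤ ℓ := fun x => (card_le_univ _).trans (by simp)
  have hwW : w ∈ W := by
    by_contra hcon
    simp only [hW, mem_union, mem_image, mem_univ, true_and, not_or, not_exists] at hcon
    apply hw
    rw [filter_eq_empty_iff.2 (fun i _ => hcon.1 i), filter_eq_empty_iff.2 (fun i _ => hcon.2 i)]
  have hWcard : W.card ≤ 2 * ℓ := by
    refine (card_union_le _ _).trans ?_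
    have h1 : (univ.image u).card ≤ ℓ := card_image_le.trans (by simp)
    have h2 : (univ.image v).card ≤ ℓ := card_image_le.trans (by simp)
    omega
  set P : Polynomial (ZMod p) := ∑ x ∈ W, Polynomial.C ((cu x : ZMod p) - cv x) *
    ∏ y ∈ W.erase x, (Polynomial.X + Polynomial.C (y : ZMod p)) ^ s with hP
  have heval : ∀ b, P.eval b = ∑ x ∈ W, ((cu x : ZMod p) - cv x) *
      ∏ y ∈ W.erase x, (b + (y : ZMod p)) ^ s := by
    intro b
    simp [hP, Polynomial.eval_finsetSum, Polynomial.eval_prod]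
  have hP0 : P ≠ 0 := by
    intro h0
    have h1 := heval (-(w : ZMod p))
    rw [h0, Polynomial.eval_zero, Finset.sum_eq_single w] at h1
    · rw [eq_comm, mul_eq_zero] at h1
      rcases h1 with h1 | h1
      · exact hw (hcast _ ((hcule w).trans_lt hℓ) _ ((hcvle w).trans_lt hℓ) (sub_eq_zero.1 h1))
      · rw [Finset.prod_eq_zero_iff] at h1
        obtain ⟨y, hy, hy0⟩ := h1
        rw [mem_erase] at hy
        have := eq_zero_of_pow_eq_zero hy0
        exact hy.1 (hcast _ (hWp y hy.2) _ (hWp w hwW) (by linear_combination this))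
    · intro x hx hxw
      rw [Finset.prod_eq_zero (i := w), mul_zero]
      · exact mem_erase.2 ⟨hxw.symm, hwW⟩
      · simp [hs.ne']
    · exact fun h => absurd hwW h
  have hdeg : P.natDegree ≤ 2 * ℓ * s := by
    rw [hP]
    refine Polynomial.natDegree_sum_le_of_forall_le _ _ (fun x _ => ?_)
    refine (Polynomial.natDegree_C_mul_le _ _).trans ((Polynomial.natDegree_prod_le _ _).trans ?_)
    calc ∑ y ∈ W.erase x, ((Polynomial.X + Polynomial.C (y : ZMod p)) ^ s).natDegree
        ≤ ∑ y ∈ W.erase x, s := by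
          refine sum_le_sum fun y _ => ?_
          refine Polynomial.natDegree_pow_le.trans ?_
          rw [Polynomial.natDegree_X_add_C, mul_one]
      _ = (W.erase x).card * s := by simp
      _ ≤ 2 * ℓ * s := Nat.mul_le_mul_right _ ((card_le_card (erase_subset _ _)).trans hWcard)
  have hsum : ∀ (t : Fin ℓ → ℕ) (g : ℕ → ZMod p), (∀ i, t i ∈ W) →
      ∑ i, g (t i) = ∑ x ∈ W, ((univ.filter (fun i => t i = x)).card : ZMod p) * g x := by
    intro t g ht
    rw [← Finset.sum_fiberwise_of_maps_to (s := univ) (t := W) (g := t) (fun i _ => ht i)]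
    refine sum_congr rfl fun x _ => ?_
    rw [Finset.sum_congr rfl (g := fun _ => g x), sum_const, nsmul_eq_mul]
    intro i hi
    rw [(mem_filter.1 hi).2]
  refine le_trans ?_ ((Polynomial.card_roots' P).trans hdeg)
  refine le_trans (card_le_card ?_) (Multiset.toFinset_card_le P.roots)
  intro b hb
  obtain ⟨-, hb1, hb2, hb3⟩ := mem_filter.1 hb
  rw [Multiset.mem_toFinset, Polynomial.mem_roots hP0, Polynomial.IsRoot, heval]
  have hbW : ∀ x ∈ W, b + (x : ZMod p) ≠ 0 := by
    intro x hx
    simp only [hW, mem_union, mem_image, mem_univ, true_and] at hx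
    rcases hx with ⟨i, rfl⟩ | ⟨i, rfl⟩
    · exact hb1 i
    · exact hb2 i
  rw [hsum u (fun x => ((b + (x : ZMod p)) ^ s)⁻¹) (fun i => by simp [hW]),
    hsum v (fun x => ((b + (x : ZMod p)) ^ s)⁻¹) (fun i => by simp [hW]), ← sub_eq_zero,
    ← sum_sub_distrib] at hb3
  calc ∑ x ∈ W, ((cu x : ZMod p) - cv x) * ∏ y ∈ W.erase x, (b + (y : ZMod p)) ^ s
      = ∑ x ∈ W, (∏ y ∈ W, (b + (y : ZMod p)) ^ s) *
        ((cu x : ZMod p) * ((b + (x : ZMod p)) ^ s)⁻¹ - (cv x : ZMod p) * ((b + (x : ZMod p)) ^ s)⁻¹) := by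
        refine sum_congr rfl fun x hx => ?_
        rw [← Finset.mul_prod_erase W _ hx]
        have := pow_ne_zero s (hbW x hx)
        field_simp
    _ = 0 := by rw [← mul_sum, hb3, mul_zero]

lemma ap_count (A : Finset ℤ) (a b d : ℤ) (hd : 0 < d) (hab : a ≤ b) (hA : ∀ x ∈ A, a ≤ x ∧ x ≤ b)
    (hdiv : ∀ x ∈ A, ∀ y ∈ A, d ∣ x - y) : (A.card : ℝ) ≤ ((b : ℝ) - a) / d + 1 := by
  have hd' : (0 : ℝ) < d := by exact_mod_cast hd
  have hab' : (a : ℝ) ≤ b := by exact_mod_cast hab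
  rcases A.eq_empty_or_nonempty with rfl | hne
  · have : 0 ≤ ((b : ℝ) - a) / d := div_nonneg (by linarith) hd'.le
    simp; linarith
  · set m := A.min' hne
    have hm : m ∈ A := A.min'_mem hne
    have hinj : A.card ≤ (Finset.Icc (0 : ℤ) ((b - a) / d)).card := by
      refine Finset.card_le_card_of_injOn (fun x => (x - m) / d) ?_ ?_
      · intro x hx
        have h1 := A.min'_le x hx
        have h2 := hA x hx
        have h3 := hA m hm
        simp only [coe_Icc, Set.mem_Icc]
        exact ⟨Int.ediv_nonneg (by omega) hd.le, Int.ediv_le_ediv hd (by omega)⟩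
      · intro x hx y hy hxy
        simp only at hxy
        have h1 := Int.ediv_mul_cancel (hdiv x hx m hm)
        have h2 := Int.ediv_mul_cancel (hdiv y hy m hm)
        rw [hxy] at h1
        omega
    rw [Int.card_Icc] at hinj
    have h0 : 0 ≤ (b - a) / d := Int.ediv_nonneg (by omega) hd.le
    have h4 : (A.card : ℤ) ≤ (b - a) / d + 1 := by omega
    have h5 : (((b - a) / d : ℤ) : ℝ) ≤ ((b : ℝ) - a) / d := by
      rw [le_div_iff₀ hd']
      exact_mod_cast Int.ediv_mul_le (b - a) hd.ne'
    have h6 : (A.card : ℝ) ≤ (((b - a) / d : ℤ) : ℝ) + 1 := by exact_mod_cast h4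
    linarith

def goodSol (p s ℓ : ℕ) (b : ZMod p) (q : (Fin ℓ → ℕ) × (Fin ℓ → ℕ)) : Prop :=
  (∀ i, b + (q.1 i : ZMod p) ≠ 0) ∧ (∀ i, b + (q.2 i : ZMod p) ≠ 0) ∧
      ∑ i, ((b + (q.1 i : ZMod p)) ^ s)⁻¹ = ∑ i, ((b + (q.2 i : ZMod p)) ^ s)⁻¹

open Classical in
lemma sum_good (p : ℕ) [Fact p.Prime] (s ℓ M : ℕ) (hs : 0 < s) (hℓ : ℓ < p) (hM : M ≤ p)
    (B : Finset (ZMod p)) :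
    ∑ b ∈ B, (((Fintype.piFinset (fun _ : Fin ℓ => range M)) ×ˢ
      (Fintype.piFinset (fun _ : Fin ℓ => range M))).filter (fun q => goodSol p s ℓ b q)).card
      ≤ 2 * ℓ * s * M ^ (2 * ℓ) + B.card * (ℓ ^ ℓ * M ^ ℓ) := by
  set Q := (Fintype.piFinset (fun _ : Fin ℓ => range M)) ×ˢ
      (Fintype.piFinset (fun _ : Fin ℓ => range M)) with hQ
  have hQc : Q.card = M ^ (2 * ℓ) := by
    rw [hQ, card_product, Fintype.card_piFinset_const, card_range, two_mul, pow_add]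
  set triv : (Fin ℓ → ℕ) × (Fin ℓ → ℕ) → Prop := fun q => ∀ w,
    (univ.filter (fun i => q.1 i = w)).card = (univ.filter (fun i => q.2 i = w)).card with htriv
  have htr : (Q.filter triv).card ≤ ℓ ^ ℓ * M ^ ℓ := by
    have hex : ∀ q : (Fin ℓ → ℕ) × (Fin ℓ → ℕ), triv q → ∃ σ : Fin ℓ → Fin ℓ,
        ∀ j, q.1 (σ j) = q.2 j := by
      intro q hq
      have : ∀ j, ∃ i, q.1 i = q.2 j := by
        intro j
        have h1 : 0 < (univ.filter (fun i => q.1 i = q.2 j)).card := by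
          rw [hq (q.2 j)]
          exact card_pos.2 ⟨j, by simp⟩
        obtain ⟨i, hi⟩ := card_pos.1 h1
        exact ⟨i, (mem_filter.1 hi).2⟩
      choose σ hσ using this
      exact ⟨σ, hσ⟩
    have : Nonempty (Fin ℓ → Fin ℓ) := ⟨id⟩
    choose! σ hσ using hex
    have hcard : ((Finset.univ : Finset (Fin ℓ → Fin ℓ)) ×ˢ
        (Fintype.piFinset (fun _ : Fin ℓ => range M))).card = ℓ ^ ℓ * M ^ ℓ := by
      rw [card_product, Fintype.card_piFinset_const, card_range]
      simp
    rw [← hcard]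
    refine card_le_card_of_injOn (fun q => (σ q, q.1)) ?_ ?_
    · intro q hq
      have hq' := (mem_filter.1 hq).1
      rw [hQ, mem_product] at hq'
      simp only [coe_product, Set.mem_prod, mem_coe, mem_univ, true_and]
      exact hq'.1
    · intro q hq q' hq' h
      have h1 := hσ q (mem_filter.1 hq).2
      have h2 := hσ q' (mem_filter.1 hq').2
      simp only [Prod.mk.injEq] at h
      refine Prod.ext h.2 (funext fun j => ?_)
      rw [← h1, ← h2, h.1, h.2]
  have hone : ∀ q ∈ Q, (B.filter (fun b => goodSol p s ℓ b q)).card ≤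
      2 * ℓ * s + if triv q then B.card else 0 := by
    intro q hq
    by_cases ht : triv q
    · rw [if_pos ht]
      exact (card_le_card (filter_subset _ _)).trans (Nat.le_add_left _ _)
    · rw [if_neg ht, add_zero]
      simp only [htriv, not_forall] at ht
      obtain ⟨w, hw⟩ := ht
      rw [hQ, mem_product, Fintype.mem_piFinset, Fintype.mem_piFinset] at hq
      refine le_trans (card_le_card ?_) (root_count p s ℓ hs hℓ q.1 q.2
        (fun i => (mem_range.1 (hq.1 i)).trans_le hM) (fun i => (mem_range.1 (hq.2 i)).trans_le hM) w hw)
      intro b hb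
      exact mem_filter.2 ⟨mem_univ _, (mem_filter.1 hb).2⟩
  calc ∑ b ∈ B, (Q.filter (fun q => goodSol p s ℓ b q)).card
      = ∑ q ∈ Q, (B.filter (fun b => goodSol p s ℓ b q)).card := by
        simp_rw [card_filter]
        exact sum_comm
    _ ≤ ∑ q ∈ Q, (2 * ℓ * s + if triv q then B.card else 0) := sum_le_sum hone
    _ = 2 * ℓ * s * M ^ (2 * ℓ) + (Q.filter triv).card * B.card := by
        rw [sum_add_distrib, sum_const, hQc, ← sum_filter, sum_const, smul_eq_mul, smul_eq_mul, mul_comm]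
    _ ≤ _ := by
        rw [mul_comm (B.card)]
        gcongr

lemma pair_count (p : ℕ) (hp : p.Prime) (T H : ℕ) (hH : 1 ≤ H) (hTp : T < p) (a : ℤ) (t t' : ℕ)
    (ht : 1 ≤ t) (ht' : 1 ≤ t') (htT : t ≤ T) (htT' : t' ≤ T) :
    ((((Icc a (a + 2 * H - 1)) ×ˢ (Icc a (a + 2 * H - 1))).filter
      (fun q => (p : ℤ) ∣ q.1 * t' - q.2 * t)).card : ℝ) ≤
      (4 * H * T / (p * (Nat.gcd t t' : ℝ)) + 1) * (2 * H * (Nat.gcd t t' : ℝ) / t + 1) := by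
  set A := ((Icc a (a + 2 * H - 1)) ×ˢ (Icc a (a + 2 * H - 1))).filter
      (fun q : ℤ × ℤ => (p : ℤ) ∣ q.1 * t' - q.2 * t) with hA
  set g := Nat.gcd t t' with hg
  have hg0 : 0 < g := Nat.gcd_pos_of_pos_left _ ht
  obtain ⟨m, hm⟩ : g ∣ t := Nat.gcd_dvd_left _ _
  obtain ⟨m', hm'⟩ : g ∣ t' := Nat.gcd_dvd_right _ _
  have hm0 : 0 < m := Nat.pos_of_ne_zero (by rintro rfl; omega)
  have hcop : Nat.Coprime m m' := by
    have := Nat.gcd_mul_left g m m'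
    rw [← hm, ← hm', ← hg] at this
    exact Nat.eq_of_mul_eq_mul_left hg0 (by rw [← this, mul_one])
  have hp0 : (0 : ℝ) < p := by exact_mod_cast hp.pos
  have hgR : (0 : ℝ) < g := by exact_mod_cast hg0
  have hmR : (0 : ℝ) < m := by exact_mod_cast hm0
  have hHR : (1 : ℝ) ≤ H := by exact_mod_cast hH
  have hmem : ∀ q ∈ A, (a ≤ q.1 ∧ q.1 ≤ a + 2 * H - 1) ∧ (a ≤ q.2 ∧ q.2 ≤ a + 2 * H - 1) ∧
      (p : ℤ) ∣ q.1 * t' - q.2 * t := by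
    intro q hq
    rw [hA, mem_filter, mem_product, mem_Icc, mem_Icc] at hq
    exact ⟨hq.1.1, hq.1.2, hq.2⟩
  set F : ℤ × ℤ → ℤ := fun q => q.1 * t' - q.2 * t with hF
  have htR : (t : ℝ) ≤ T := by exact_mod_cast htT
  have htR' : (t' : ℝ) ≤ T := by exact_mod_cast htT'
  have himg : ((A.image F).card : ℝ) ≤ 4 * H * T / (p * (g : ℝ)) + 1 := by
    have h1 := ap_count (A.image F) (a * t' - (a + 2 * H - 1) * t) ((a + 2 * H - 1) * t' - a * t)
      (p * g) (by have := hp.pos; positivity) (by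
        have h1 : (0 : ℤ) ≤ (2 * H - 1) * t' := mul_nonneg (by omega) (by omega)
        have h2 : (0 : ℤ) ≤ (2 * H - 1) * t := mul_nonneg (by omega) (by omega)
        linarith) (by
        intro x hx
        obtain ⟨q, hq, rfl⟩ := mem_image.1 hx
        obtain ⟨h1, h2, -⟩ := hmem q hq
        have e1 := mul_le_mul_of_nonneg_right h1.1 (Int.natCast_nonneg t')
        have e2 := mul_le_mul_of_nonneg_right h1.2 (Int.natCast_nonneg t')
        have e3 := mul_le_mul_of_nonneg_right h2.1 (Int.natCast_nonneg t)
        have e4 := mul_le_mul_of_nonneg_right h2.2 (Int.natCast_nonneg t)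
        simp only [hF]
        constructor <;> linarith) (by
        have hd : ∀ x ∈ A.image F, ((p : ℤ) * g) ∣ x := by
          intro x hx
          obtain ⟨q, hq, rfl⟩ := mem_image.1 hx
          obtain ⟨-, -, h3⟩ := hmem q hq
          have hcp : IsCoprime (p : ℤ) (g : ℤ) := by
            rw [Nat.isCoprime_iff_coprime, hp.coprime_iff_not_dvd]
            intro hdvd
            have h4 := Nat.le_of_dvd hg0 hdvd
            have h5 := Nat.le_of_dvd ht (Nat.gcd_dvd_left t t')
            omega
          refine hcp.mul_dvd h3 ⟨q.1 * m' - q.2 * m, ?_⟩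
          simp only [hF]
          rw [hm, hm']
          push_cast
          ring
        intro x hx y hy
        exact dvd_sub (hd x hx) (hd y hy))
    refine h1.trans ?_
    push_cast
    gcongr
    nlinarith
  have hfib : ∀ n : ℤ, ((A.filter (fun q => F q = n)).card : ℝ) ≤ 2 * H * (g : ℝ) / t + 1 := by
    intro n
    have hinj : Set.InjOn (Prod.fst : ℤ × ℤ → ℤ) (A.filter (fun q => F q = n)) := by
      intro q hq q' hq' h
      have h1 := (mem_filter.1 hq).2
      have h2 := (mem_filter.1 hq').2
      simp only [hF] at h1 h2
      refine Prod.ext h ?_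
      have : (q.2 - q'.2) * (t : ℤ) = 0 := by rw [h] at h1; linarith
      rcases mul_eq_zero.1 this with h3 | h3
      · linarith
      · omega
    rw [← card_image_of_injOn hinj]
    have h1 := ap_count ((A.filter (fun q => F q = n)).image Prod.fst) a (a + 2 * H - 1) m
      (by exact_mod_cast hm0) (by omega) (by
        intro x hx
        obtain ⟨q, hq, rfl⟩ := mem_image.1 hx
        exact (hmem q (mem_filter.1 hq).1).1) (by
        intro x hx y hy
        obtain ⟨q, hq, rfl⟩ := mem_image.1 hx
        obtain ⟨q', hq', rfl⟩ := mem_image.1 hy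
        have h1 := (mem_filter.1 hq).2
        have h2 := (mem_filter.1 hq').2
        simp only [hF] at h1 h2
        rw [hm, hm'] at h1 h2
        push_cast at h1 h2
        have h3 : (g : ℤ) * ((q.1 - q'.1) * m') = g * ((q.2 - q'.2) * m) := by linarith
        have h4 := mul_left_cancel₀ (by positivity) h3
        have h5 : (m : ℤ) ∣ (q.1 - q'.1) * m' := ⟨q.2 - q'.2, by rw [h4]; ring⟩
        exact (Nat.isCoprime_iff_coprime.2 hcop).dvd_of_dvd_mul_right h5)
    refine h1.trans ?_
    rw [hm]
    push_cast
    have e : 2 * (H : ℝ) * g / (g * m) = 2 * H / m := by field_simp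
    rw [e]
    gcongr
    linarith
  rw [card_eq_sum_card_image F A]
  push_cast
  calc ∑ n ∈ A.image F, ((A.filter (fun q => F q = n)).card : ℝ)
      ≤ ∑ n ∈ A.image F, (2 * H * (g : ℝ) / t + 1) := sum_le_sum fun n _ => hfib n
    _ = (A.image F).card * (2 * H * (g : ℝ) / t + 1) := by rw [sum_const, nsmul_eq_mul]
    _ ≤ _ := by gcongr

noncomputable def hsum (T : ℕ) : ℝ := ∑ t ∈ Icc 1 T, (1 / (t : ℝ))

lemma hsum_ge_one (T : ℕ) (hT : 1 ≤ T) : 1 ≤ hsum T := by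
  have h := single_le_sum (f := fun t : ℕ => (1 / (t : ℝ))) (s := Icc 1 T) (fun i _ => by positivity)
    (mem_Icc.2 ⟨le_refl 1, hT⟩)
  simpa [hsum] using h

lemma hsum_le_log (T : ℕ) : hsum T ≤ 1 + Real.log T := by
  have h := harmonic_le_one_add_log T
  rw [harmonic_eq_sum_Icc] at h
  push_cast at h
  simpa [hsum] using h

lemma hsum_dvd (T d : ℕ) (hd : 1 ≤ d) :
    ∑ t ∈ (Icc 1 T).filter (fun t => d ∣ t), (1 / (t : ℝ)) ≤ hsum T / d := by
  have hd' : (0 : ℝ) < d := by exact_mod_cast hd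
  have hdv : ∀ t ∈ (Icc 1 T).filter (fun t => d ∣ t), d * (t / d) = t := by
    intro t ht
    exact Nat.mul_div_cancel' (mem_filter.1 ht).2
  have hinj : Set.InjOn (fun t => t / d) ((Icc 1 T).filter (fun t => d ∣ t) : Finset ℕ) := by
    intro x hx y hy h
    rw [← hdv x hx, ← hdv y hy]
    simp only at h
    rw [h]
  calc ∑ t ∈ (Icc 1 T).filter (fun t => d ∣ t), (1 / (t : ℝ))
      = ∑ t ∈ (Icc 1 T).filter (fun t => d ∣ t), (1 / (((t / d : ℕ)) : ℝ)) / d := by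
        refine sum_congr rfl fun t ht => ?_
        conv_lhs => rw [← hdv t ht]
        push_cast
        rw [div_div, mul_comm]
    _ = (∑ m ∈ ((Icc 1 T).filter (fun t => d ∣ t)).image (fun t => t / d), (1 / (m : ℝ))) / d := by
        rw [sum_image hinj, sum_div]
    _ ≤ _ := by
        unfold hsum
        gcongr
        intro m hm
        obtain ⟨t, ht, rfl⟩ := mem_image.1 hm
        have h1 := hdv t ht
        have h2 := mem_Icc.1 (mem_filter.1 ht).1
        rw [mem_Icc]
        refine ⟨Nat.pos_of_ne_zero fun h0 => ?_, (Nat.div_le_self _ _).trans h2.2⟩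
        rw [h0] at h1
        omega

lemma gcd_sum (T : ℕ) :
    ∑ t ∈ Icc 1 T, ∑ t' ∈ Icc 1 T, (Nat.gcd t t' : ℝ) / t ≤ T * hsum T ^ 2 := by
  have h1 : ∀ t ∈ Icc 1 T, ∀ t' ∈ Icc 1 T, (Nat.gcd t t' : ℝ) / t ≤
      ∑ d ∈ Icc 1 T, (if d ∣ t then (1 / (t : ℝ)) else 0) * (if d ∣ t' then (d : ℝ) else 0) := by
    intro t ht t' ht'
    have hmem : Nat.gcd t t' ∈ Icc 1 T := by
      rw [mem_Icc] at *
      exact ⟨Nat.gcd_pos_of_pos_left _ ht.1, (Nat.gcd_le_left _ ht.1).trans ht.2⟩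
    have := single_le_sum (f := fun d : ℕ => (if d ∣ t then (1 / (t : ℝ)) else 0) *
      (if d ∣ t' then (d : ℝ) else 0)) (s := Icc 1 T) (fun d _ => by positivity) hmem
    refine le_trans (le_of_eq ?_) this
    simp only [Nat.gcd_dvd_left, Nat.gcd_dvd_right, if_true]
    ring
  calc _ ≤ ∑ t ∈ Icc 1 T, ∑ t' ∈ Icc 1 T, ∑ d ∈ Icc 1 T, (if d ∣ t then (1 / (t : ℝ)) else 0) *
        (if d ∣ t' then (d : ℝ) else 0) := sum_le_sum fun t ht => sum_le_sum fun t' ht' => h1 t ht t' ht'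
    _ = ∑ d ∈ Icc 1 T, (∑ t ∈ Icc 1 T, (if d ∣ t then (1 / (t : ℝ)) else 0)) *
        (∑ t' ∈ Icc 1 T, (if d ∣ t' then (d : ℝ) else 0)) := by
        simp_rw [sum_mul_sum]
        rw [sum_comm' (t' := Icc 1 T) (s' := fun _ => Icc 1 T) (by simp)]
        rw [sum_comm]
        rw [sum_comm]
        conv_rhs => rw [sum_comm]
        rw [sum_comm]
        exact sum_congr rfl fun t _ => sum_comm
    _ ≤ ∑ d ∈ Icc 1 T, (hsum T / d) * T := by
        refine sum_le_sum fun d hd => ?_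
        have hd1 := (mem_Icc.1 hd).1
        have hT : 0 ≤ hsum T := sum_nonneg fun i _ => by positivity
        rw [← sum_filter, ← sum_filter]
        have h2 : ∑ t' ∈ (Icc 1 T).filter (fun t' => d ∣ t'), (d : ℝ) ≤ T := by
          rw [sum_const, nsmul_eq_mul]
          have : (Icc 1 T).filter (fun t' => d ∣ t') = (Ioc 0 T).filter (fun t' => d ∣ t') := rfl
          rw [this, Nat.Ioc_filter_dvd_card_eq_div]
          exact_mod_cast Nat.div_mul_le_self T d
        exact mul_le_mul (hsum_dvd T d hd1) h2 (sum_nonneg fun i _ => by positivity) (by positivity)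
    _ = T * hsum T ^ 2 := by
        rw [← sum_mul]
        have : ∑ d ∈ Icc 1 T, hsum T / (d : ℝ) = hsum T * hsum T := by
          conv_rhs => rw [hsum, mul_sum]
          refine sum_congr rfl fun d _ => ?_
          rw [hsum]; ring
        rw [this]; ring

lemma energy (p : ℕ) [Fact p.Prime] (T H : ℕ) (hT : 1 ≤ T) (hTH : T ≤ H) (hTp : T < p) (a : ℤ) :
    ∑ i ∈ (Icc a (a + 2 * H - 1)) ×ˢ (Icc 1 T), ((((Icc a (a + 2 * H - 1)) ×ˢ (Icc 1 T)).filter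
      (fun j : ℤ × ℕ => (j.1 : ZMod p) / (j.2 : ZMod p) = (i.1 : ZMod p) / (i.2 : ZMod p))).card : ℝ)
      ≤ hsum T ^ 2 * (12 * (H * T) ^ 2 / p + 3 * (H * T)) := by
  have hp : p.Prime := Fact.out
  set I := Icc a (a + 2 * H - 1) with hI
  have hunit : ∀ t ∈ Icc 1 T, (t : ZMod p) ≠ 0 := by
    intro t ht h0
    rw [ZMod.natCast_eq_zero_iff] at h0
    have := mem_Icc.1 ht
    have := Nat.le_of_dvd this.1 h0
    omega
  have e1 : ∑ i ∈ I ×ˢ (Icc 1 T), (((I ×ˢ (Icc 1 T)).filter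
      (fun j : ℤ × ℕ => (j.1 : ZMod p) / (j.2 : ZMod p) = (i.1 : ZMod p) / (i.2 : ZMod p))).card : ℝ)
      = ∑ t ∈ Icc 1 T, ∑ t' ∈ Icc 1 T, (((I ×ˢ I).filter
      (fun q => (p : ℤ) ∣ q.1 * t' - q.2 * t)).card : ℝ) := by
    simp_rw [card_filter, Nat.cast_sum]
    rw [sum_product_right]
    refine sum_congr rfl fun t ht => ?_
    simp_rw [sum_product_right (s := I) (t := Icc 1 T)]
    rw [sum_comm]
    refine sum_congr rfl fun t' ht' => ?_
    rw [sum_product]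
    refine sum_congr rfl fun c _ => sum_congr rfl fun c' _ => ?_
    congr 1
    have h1 := hunit t ht
    have h2 := hunit t' ht'
    have : ((c' : ZMod p) / (t' : ZMod p) = (c : ZMod p) / (t : ZMod p)) ↔
        (p : ℤ) ∣ c * t' - c' * t := by
      rw [div_eq_div_iff h2 h1, ← ZMod.intCast_zmod_eq_zero_iff_dvd]
      push_cast
      rw [sub_eq_zero, eq_comm]
    simp only [this]
  rw [e1]
  have hp0 : (0 : ℝ) < p := by exact_mod_cast hp.pos
  have hh := hsum_ge_one T hT
  have hTR : (1 : ℝ) ≤ T := by exact_mod_cast hT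
  have hTHR : (T : ℝ) ≤ H := by exact_mod_cast hTH
  calc _ ≤ ∑ t ∈ Icc 1 T, ∑ t' ∈ Icc 1 T, (8 * H ^ 2 * T / p * (1 / (t : ℝ)) + 4 * H * T / p +
        2 * H * ((Nat.gcd t t' : ℝ) / t) + 1) := by
        refine sum_le_sum fun t ht => sum_le_sum fun t' ht' => ?_
        rw [mem_Icc] at ht ht'
        refine (pair_count p hp T H (hT.trans hTH) hTp a t t' ht.1 ht'.1 ht.2 ht'.2).trans ?_
        have hg : (1 : ℝ) ≤ (Nat.gcd t t' : ℝ) := by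
          exact_mod_cast Nat.gcd_pos_of_pos_left _ ht.1
        have htR : (0 : ℝ) < t := by exact_mod_cast ht.1
        set g : ℝ := (Nat.gcd t t' : ℝ)
        have h3 : 4 * H * T / (p * g) ≤ 4 * H * T / p := by
          apply div_le_div_of_nonneg_left (by positivity) hp0
          nlinarith
        have h4 : 4 * H * T / (p * g) * (2 * H * g / t) = 8 * H ^ 2 * T / p * (1 / (t : ℝ)) := by
          field_simp
          ring
        have h5 : 2 * H * g / t = 2 * H * (g / t) := by ring
        linarith
    _ = 8 * H ^ 2 * T ^ 2 / p * hsum T + 4 * H * T ^ 3 / p +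
        2 * H * (∑ t ∈ Icc 1 T, ∑ t' ∈ Icc 1 T, (Nat.gcd t t' : ℝ) / t) + T ^ 2 := by
        simp_rw [sum_add_distrib, ← mul_sum, sum_const]
        simp only [Nat.card_Icc, nsmul_eq_mul, ← mul_sum, Nat.add_sub_cancel]
        rw [← hsum]
        ring
    _ ≤ 8 * H ^ 2 * T ^ 2 / p * hsum T ^ 2 + 4 * (H * T) ^ 2 / p * hsum T ^ 2 +
        2 * H * (T * hsum T ^ 2) + H * T * hsum T ^ 2 := by
        have hh2 : 1 ≤ hsum T ^ 2 := one_le_pow₀ hh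
        gcongr
        · nlinarith
        · calc 4 * (H : ℝ) * T ^ 3 / p ≤ 4 * (H * T) ^ 2 / p := by
                apply div_le_div_of_nonneg_right _ hp0.le
                have : (0:ℝ) ≤ 4 * H * T ^ 2 := by positivity
                nlinarith
            _ ≤ 4 * (H * T) ^ 2 / p * hsum T ^ 2 := le_mul_of_one_le_right (by positivity) hh2
        · exact gcd_sum T
        · calc (T : ℝ) ^ 2 ≤ H * T := by nlinarith
            _ ≤ _ := le_mul_of_one_le_right (by positivity) hh2
    _ = _ := by ring

lemma ap_sum (L : ℤ) (H M T : ℕ) (hTM : T * M ≤ H) (g : ℤ → ℂ) :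
    ∑ i ∈ (Icc (L + 1 - H) (L + 1 - H + 2 * H - 1)) ×ˢ (Icc 1 T),
      ∑ u ∈ (range M).filter (fun u : ℕ => i.1 + (i.2 : ℤ) * u ∈ Icc (L + 1) (L + H)),
        g (i.1 + (i.2 : ℤ) * u) = (M * T : ℂ) * ∑ x ∈ Icc (L + 1) (L + H), g x := by
  rw [sum_product_right]
  have h1 : ∀ t ∈ Icc 1 T, ∀ u ∈ range M,
      ∑ c ∈ Icc (L + 1 - H) (L + 1 - H + 2 * H - 1),
        (if c + (t : ℤ) * u ∈ Icc (L + 1) (L + H) then g (c + (t : ℤ) * u) else 0) =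
      ∑ x ∈ Icc (L + 1) (L + H), g x := by
    intro t ht u hu
    rw [← sum_filter]
    have h2 : (t : ℤ) * u ≤ H := by
      have : t * u ≤ H := le_trans (Nat.mul_le_mul (mem_Icc.1 ht).2 (mem_range.1 hu).le) hTM
      exact_mod_cast this
    have h3 : (0 : ℤ) ≤ (t : ℤ) * u := by positivity
    refine sum_nbij' (fun c => c + (t : ℤ) * u) (fun x => x - (t : ℤ) * u) ?_ ?_ ?_ ?_ ?_
    · intro c hc
      exact (mem_filter.1 hc).2
    · intro x hx
      rw [mem_filter, sub_add_cancel]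
      refine ⟨?_, hx⟩
      rw [mem_Icc] at hx ⊢
      constructor <;> linarith
    · intro c _; ring
    · intro c _; ring
    · intro c _; rfl
  calc _ = ∑ t ∈ Icc 1 T, ∑ u ∈ range M, ∑ c ∈ Icc (L + 1 - H) (L + 1 - H + 2 * H - 1),
        (if c + (t : ℤ) * u ∈ Icc (L + 1) (L + H) then g (c + (t : ℤ) * u) else 0) := by
        refine sum_congr rfl fun t _ => ?_
        simp_rw [sum_filter]
        exact sum_comm
    _ = ∑ t ∈ Icc 1 T, ∑ u ∈ range M, ∑ x ∈ Icc (L + 1) (L + H), g x :=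
        sum_congr rfl fun t ht => sum_congr rfl fun u hu => h1 t ht u hu
    _ = _ := by
        simp only [sum_const, card_range, Nat.card_Icc, nsmul_eq_mul, Nat.add_sub_cancel]
        ring

set_option maxHeartbeats 400000 in
open Classical in
lemma main_ineq (p : ℕ) [Fact p.Prime] (s ℓ : ℕ) (hs : 0 < s) (hℓ : 0 < ℓ) (hℓp : ℓ < p)
    (L : ℤ) (H M T : ℕ) (hH : 1 ≤ H) (hL : 0 ≤ L) (hLp : L + H ≤ (p : ℤ) - 1)
    (hM : 1 ≤ M) (hT : 1 ≤ T) (hTM : T * M ≤ H) :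
    ∃ N : ℕ, N ≤ p ∧ N ≤ 2 * H * T ∧
    ((M * T : ℝ)) ^ (2 * ℓ) *
      (solCount p (Icc (L + 1) (L + H)) (fun x : ℤ => ((x : ZMod p) ^ s)⁻¹) ℓ : ℝ) ≤
    (2 * H * T : ℝ) ^ (2 * (ℓ - 1)) * ((hsum T ^ 2 * (12 * (H * T) ^ 2 / p + 3 * (H * T))) *
      (2 * ℓ * s * M ^ (2 * ℓ) + N * (ℓ ^ ℓ * M ^ ℓ))) := by
  have hp : p.Prime := Fact.out
  have hTH : T ≤ H := le_trans (Nat.le_mul_of_pos_right _ hM) hTM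
  have hMH : M ≤ H := le_trans (Nat.le_mul_of_pos_left _ hT) hTM
  have hHp : H < p := by omega
  have hp0 : (0 : ℝ) < p := by exact_mod_cast hp.pos
  set P := (Icc (L + 1 - H) (L + 1 - H + 2 * H - 1)) ×ˢ (Icc 1 T) with hP
  have hPc : P.card = 2 * H * T := by
    rw [hP, card_product, Int.card_Icc, Nat.card_Icc, Nat.add_sub_cancel]
    congr 1
    omega
  set X := Icc (L + 1) (L + H) with hX
  have hX0 : ∀ x ∈ X, (x : ZMod p) ≠ 0 := by
    intro x hx h0
    rw [ZMod.intCast_zmod_eq_zero_iff_dvd] at h0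
    rw [hX, mem_Icc] at hx
    have := Int.le_of_dvd (by omega) h0
    omega
  set key : ℤ × ℕ → ZMod p := fun j => (j.1 : ZMod p) / (j.2 : ZMod p) with hkey
  set U : ℤ × ℕ → Finset ℕ := fun i => (range M).filter (fun u : ℕ => i.1 + (i.2 : ℤ) * u ∈ X) with hU
  set f : ℤ × ℕ → ℕ → ZMod p := fun i u => (((i.1 + (i.2 : ℤ) * u : ℤ) : ZMod p) ^ s)⁻¹ with hf
  set r : ℤ × ℕ → ℝ := fun i => ((P.filter (fun j => key j = key i)).card : ℝ) with hr
  set Js : ZMod p → ℕ := fun b => (((Fintype.piFinset (fun _ : Fin ℓ => range M)) ×ˢ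
      (Fintype.piFinset (fun _ : Fin ℓ => range M))).filter (fun q => goodSol p s ℓ b q)).card with hJs
  set B := P.image key with hB
  set J := solCount p X (fun x : ℤ => ((x : ZMod p) ^ s)⁻¹) ℓ with hJ
  have hrpos : ∀ i ∈ P, 0 < r i := by
    intro i hi
    simp only [hr]
    have h0 : 0 < (P.filter (fun j => key j = key i)).card :=
      card_pos.2 ⟨i, mem_filter.2 ⟨hi, rfl⟩⟩
    exact Nat.cast_pos.2 h0
  have hE : ∑ i ∈ P, r i ≤ hsum T ^ 2 * (12 * (H * T) ^ 2 / p + 3 * (H * T)) := by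
    have := energy p T H hT hTH (by omega) (L + 1 - H)
    simp only [hr, hkey]
    convert this
  -- comparison of local counts
  have hloc : ∀ i ∈ P, solCount p (U i) (f i) ℓ ≤ Js (key i) := by
    intro i hi
    have ht0 : (i.2 : ZMod p) ≠ 0 := by
      intro h0
      rw [ZMod.natCast_eq_zero_iff] at h0
      rw [hP, mem_product, mem_Icc, mem_Icc] at hi
      have := Nat.le_of_dvd hi.2.1 h0
      omega
    have hfu : ∀ u : ℕ, key i + (u : ZMod p) = ((i.1 + (i.2 : ℤ) * u : ℤ) : ZMod p) / i.2 := by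
      intro u
      simp only [hkey]
      push_cast
      field_simp
    have hne : ∀ u ∈ U i, key i + (u : ZMod p) ≠ 0 := by
      intro u hu
      rw [hfu]
      exact div_ne_zero (hX0 _ (mem_filter.1 hu).2) ht0
    have hval : ∀ u : ℕ, ((key i + (u : ZMod p)) ^ s)⁻¹ = (i.2 : ZMod p) ^ s * f i u := by
      intro u
      rw [hfu, div_pow, inv_div, hf]
      rfl
    simp only [solCount, hJs]
    refine card_le_card fun q hq => ?_
    rw [mem_filter, mem_product, Fintype.mem_piFinset, Fintype.mem_piFinset] at hq ⊢
    refine ⟨⟨fun j => (mem_filter.1 (hq.1.1 j)).1, fun j => (mem_filter.1 (hq.1.2 j)).1⟩,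
      fun j => hne _ (hq.1.1 j), fun j => hne _ (hq.1.2 j), ?_⟩
    simp_rw [hval]
    rw [← mul_sum, ← mul_sum, hq.2]
  have hsumloc : ∑ i ∈ P, (solCount p (U i) (f i) ℓ : ℝ) / r i ≤ ∑ b ∈ B, (Js b : ℝ) := by
    calc ∑ i ∈ P, (solCount p (U i) (f i) ℓ : ℝ) / r i ≤ ∑ i ∈ P, (Js (key i) : ℝ) / r i := by
          refine sum_le_sum fun i hi => ?_
          have := hrpos i hi
          gcongr
          exact hloc i hi
      _ = ∑ b ∈ B, ∑ i ∈ P.filter (fun i => key i = b), (Js (key i) : ℝ) / r i :=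
          (sum_fiberwise_of_maps_to (fun i hi => mem_image_of_mem _ hi) _).symm
      _ = ∑ b ∈ B, (Js b : ℝ) := by
          refine sum_congr rfl fun b hb => ?_
          obtain ⟨i0, hi0, rfl⟩ := mem_image.1 hb
          rw [sum_congr rfl (g := fun _ => (Js (key i0) : ℝ) / r i0), sum_const, nsmul_eq_mul]
          · have := (hrpos i0 hi0).ne'
            change r i0 * _ = _
            field_simp
          · intro i hi
            have := (mem_filter.1 hi).2
            simp only [hr, this]
  have hJsB : ∑ b ∈ B, (Js b : ℝ) ≤ 2 * ℓ * s * M ^ (2 * ℓ) + B.card * (ℓ ^ ℓ * M ^ ℓ) := by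
    have := sum_good p s ℓ M hs hℓp (by omega) B
    exact_mod_cast this
  refine ⟨B.card, ?_, ?_, ?_⟩
  · exact (card_le_univ B).trans (by rw [ZMod.card])
  · exact card_image_le.trans hPc.le
  have hψ : ∀ ψ : AddChar (ZMod p) ℂ,
      (M * T : ℝ) ^ (2 * ℓ) * ‖∑ x ∈ X, ψ (((x : ZMod p) ^ s)⁻¹)‖ ^ (2 * ℓ) ≤
      (2 * H * T : ℝ) ^ (2 * (ℓ - 1)) *
        ((∑ i ∈ P, r i) * ∑ i ∈ P, ‖∑ u ∈ U i, ψ (f i u)‖ ^ (2 * ℓ) / r i) := by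
    intro ψ
    have h1 := ap_sum L H M T hTM (fun x => ψ (((x : ZMod p) ^ s)⁻¹))
    have h2 : (M * T : ℝ) * ‖∑ x ∈ X, ψ (((x : ZMod p) ^ s)⁻¹)‖ ≤
        ∑ i ∈ P, ‖∑ u ∈ U i, ψ (f i u)‖ := by
      calc _ = ‖(M * T : ℂ) * ∑ x ∈ X, ψ (((x : ZMod p) ^ s)⁻¹)‖ := by
            rw [norm_mul]; simp
        _ = ‖∑ i ∈ P, ∑ u ∈ U i, ψ (f i u)‖ := by rw [← h1]
        _ ≤ _ := norm_sum_le _ _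
    rw [← mul_pow]
    refine (pow_le_pow_left₀ (by positivity) h2 _).trans ?_
    have h3 := holder_aux P (fun i => ‖∑ u ∈ U i, ψ (f i u)‖) r (fun i _ => norm_nonneg _) hrpos ℓ hℓ
    rw [hPc] at h3
    push_cast at h3
    exact h3
  have hall := sum_le_sum (s := univ) (fun ψ (_ : ψ ∈ (univ : Finset (AddChar (ZMod p) ℂ))) => hψ ψ)
  rw [← mul_sum, fourier_count p X (fun x : ℤ => ((x : ZMod p) ^ s)⁻¹) ℓ, ← mul_sum, ← mul_sum,
    sum_comm] at hall
  simp_rw [← sum_div, fourier_count, mul_div_assoc] at hall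
  rw [← mul_sum] at hall
  have hrs : 0 ≤ ∑ i ∈ P, r i := sum_nonneg fun i hi => (hrpos i hi).le
  have hall2 : (M * T : ℝ) ^ (2 * ℓ) * (J : ℝ) ≤ (2 * H * T : ℝ) ^ (2 * (ℓ - 1)) *
      ((∑ i ∈ P, r i) * ∑ i ∈ P, (solCount p (U i) (f i) ℓ : ℝ) / r i) := by
    refine le_of_mul_le_mul_left ?_ hp0
    calc _ = (M * T : ℝ) ^ (2 * ℓ) * (p * (J : ℝ)) := by ring
      _ ≤ _ := hall
      _ = _ := by ring
  refine hall2.trans ?_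
  have := hsumloc.trans hJsB
  have hE0 : 0 ≤ hsum T ^ 2 * (12 * (H * T) ^ 2 / p + 3 * (H * T)) := hrs.trans hE
  have hnn : 0 ≤ ∑ i ∈ P, (solCount p (U i) (f i) ℓ : ℝ) / r i :=
    sum_nonneg fun i hi => div_nonneg (Nat.cast_nonneg _) (hrpos i hi).le
  exact mul_le_mul_of_nonneg_left (mul_le_mul hE this hnn hE0) (by positivity)

lemma core_bound (p : ℕ) [Fact p.Prime] (s ℓ : ℕ) (hs : 0 < s) (hℓ : 0 < ℓ) (hℓp : ℓ < p)
    (L : ℤ) (H M T : ℕ) (hH : 1 ≤ H) (hL : 0 ≤ L) (hLp : L + H ≤ (p : ℤ) - 1)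
    (hM : 1 ≤ M) (hT : 1 ≤ T) (hTM : T * M ≤ H) :
    (solCount p (Icc (L + 1) (L + H)) (fun x : ℤ => ((x : ZMod p) ^ s)⁻¹) ℓ : ℝ) ≤
    3 * 4 ^ ℓ * (2 * ℓ * s + ℓ ^ ℓ) * hsum T ^ 2 * (H : ℝ) ^ (2 * ℓ) *
      (1 / p + 1 / (H * T) + 3 / (M : ℝ) ^ ℓ) := by
  obtain ⟨N, hNp, hNT, hmain⟩ := main_ineq p s ℓ hs hℓ hℓp L H M T hH hL hLp hM hT hTM
  set J : ℝ := (solCount p (Icc (L + 1) (L + H)) (fun x : ℤ => ((x : ZMod p) ^ s)⁻¹) ℓ : ℝ)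
  have hp0 : (0 : ℝ) < p := by exact_mod_cast (Fact.out : p.Prime).pos
  have hM0 : (0 : ℝ) < M := by exact_mod_cast hM
  have hT0 : (0 : ℝ) < T := by exact_mod_cast hT
  have hH0 : (0 : ℝ) < H := by exact_mod_cast hH
  have hNpR : (N : ℝ) ≤ p := by exact_mod_cast hNp
  have hNTR : (N : ℝ) ≤ 2 * (H * T) := by rw [← mul_assoc]; exact_mod_cast hNT
  have hpos : (0 : ℝ) < (M * T : ℝ) ^ (2 * ℓ) := by positivity
  refine le_of_mul_le_mul_left (hmain.trans ?_) hpos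
  set K : ℝ := 2 * ℓ * s + ℓ ^ ℓ with hK
  have hK0 : 0 ≤ K := by positivity
  set h := hsum T
  set Y : ℝ := H * T with hY
  have hY0 : 0 < Y := by positivity
  have hA : (2 * ℓ * s * M ^ (2 * ℓ) + N * (ℓ ^ ℓ * M ^ ℓ) : ℝ) ≤
      K * (M ^ (2 * ℓ) * (1 + N / M ^ ℓ)) := by
    have e : (M : ℝ) ^ (2 * ℓ) * (1 + N / M ^ ℓ) = M ^ (2 * ℓ) + N * M ^ ℓ := by
      rw [two_mul, pow_add]; field_simp
    rw [e, hK]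
    have h1 : (0 : ℝ) ≤ 2 * ℓ * s * (N * M ^ ℓ) := by positivity
    have h2 : (0 : ℝ) ≤ ℓ ^ ℓ * M ^ (2 * ℓ) := by positivity
    nlinarith
  have hB : 12 * Y ^ 2 / p + 3 * Y ≤ 12 * Y ^ 2 * (1 / p + 1 / Y) := by
    have e : 12 * Y ^ 2 * (1 / p + 1 / Y) = 12 * Y ^ 2 / p + 12 * Y := by field_simp
    rw [e]; linarith
  have hC : (1 / p + 1 / Y) * (1 + N / (M : ℝ) ^ ℓ) ≤ 1 / p + 1 / Y + 3 / (M : ℝ) ^ ℓ := by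
    have h1 : (N : ℝ) * (1 / p + 1 / Y) ≤ 3 := by
      have h2 : (N : ℝ) * (1 / p) ≤ 1 := by rw [mul_one_div, div_le_one hp0]; exact hNpR
      have h3 : (N : ℝ) * (1 / Y) ≤ 2 := by rw [mul_one_div, div_le_iff₀ hY0]; exact hNTR
      linarith
    have h4 : (N : ℝ) * (1 / p + 1 / Y) / (M : ℝ) ^ ℓ ≤ 3 / (M : ℝ) ^ ℓ := by gcongr
    calc _ = 1 / p + 1 / Y + (N : ℝ) * (1 / p + 1 / Y) / (M : ℝ) ^ ℓ := by ring
      _ ≤ _ := by linarith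
  calc _ ≤ (2 * H * T : ℝ) ^ (2 * (ℓ - 1)) * ((h ^ 2 * (12 * Y ^ 2 * (1 / p + 1 / Y))) *
        (K * (M ^ (2 * ℓ) * (1 + N / M ^ ℓ)))) := by
        gcongr
    _ = 3 * (K * h ^ 2) * ((2 * Y) ^ (2 * ℓ) * M ^ (2 * ℓ)) *
        ((1 / p + 1 / Y) * (1 + N / (M : ℝ) ^ ℓ)) := by
        have e : (2 * Y) ^ (2 * ℓ) = (2 * H * T : ℝ) ^ (2 * (ℓ - 1)) * (4 * Y ^ 2) := by
          obtain ⟨m, rfl⟩ : ∃ m, ℓ = m + 1 := ⟨ℓ - 1, by omega⟩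
          rw [Nat.add_sub_cancel, hY]
          ring
        rw [e]; ring
    _ ≤ 3 * (K * h ^ 2) * ((2 * Y) ^ (2 * ℓ) * M ^ (2 * ℓ)) *
        (1 / p + 1 / Y + 3 / (M : ℝ) ^ ℓ) := by gcongr
    _ = _ := by
        have e : (4 : ℝ) ^ ℓ = 2 ^ (2 * ℓ) := by rw [pow_mul]; norm_num
        rw [e, hY]
        simp only [mul_pow]
        ring

lemma hsum_bound (T H : ℕ) (hT : 1 ≤ T) (hTH : T ≤ H) (ε : ℝ) (hε : 0 < ε) :
    hsum T ^ 2 ≤ (1 + 2 / ε) ^ 2 * (H : ℝ) ^ ε := by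
  have hH1 : (1 : ℝ) ≤ H := by exact_mod_cast hT.trans hTH
  have hT0 : (0 : ℝ) < T := by exact_mod_cast hT
  have hTR : (T : ℝ) ≤ H := by exact_mod_cast hTH
  have h1 : hsum T ≤ (1 + 2 / ε) * (H : ℝ) ^ (ε / 2) := by
    have h2 := hsum_le_log T
    have h3 : Real.log T ≤ Real.log H := Real.log_le_log hT0 hTR
    have h4 := Real.log_le_rpow_div (by linarith : (0 : ℝ) ≤ H) (by linarith : 0 < ε / 2)
    have h5 := Real.one_le_rpow hH1 (by linarith : 0 ≤ ε / 2)
    have e : (H : ℝ) ^ (ε / 2) / (ε / 2) = 2 / ε * (H : ℝ) ^ (ε / 2) := by field_simp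
    rw [e] at h4
    linarith
  have h0 := hsum_ge_one T hT
  calc hsum T ^ 2 ≤ ((1 + 2 / ε) * (H : ℝ) ^ (ε / 2)) ^ 2 := by gcongr
    _ = _ := by
      rw [mul_pow, ← Real.rpow_natCast ((H : ℝ) ^ (ε / 2)) 2, ← Real.rpow_mul (by linarith)]
      congr 2
      push_cast; ring

lemma param_bound (p : ℕ) [Fact p.Prime] (s ℓ : ℕ) (hs : 0 < s) (hℓ : 0 < ℓ) (hℓp : ℓ < p)
    (L : ℤ) (H : ℕ) (hH : 1 ≤ H) (hL : 0 ≤ L) (hLp : L + H ≤ (p : ℤ) - 1) (ε : ℝ) (hε : 0 < ε) :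
    (solCount p (Icc (L + 1) (L + H)) (fun x : ℤ => ((x : ZMod p) ^ s)⁻¹) ℓ : ℝ) ≤
    (21 * 4 ^ ℓ * (2 * ℓ * s + ℓ ^ ℓ) * (1 + 2 / ε) ^ 2) *
      ((H : ℝ) ^ ((2 * (ℓ : ℝ) ^ 2) / ((ℓ : ℝ) + 1)) + (H : ℝ) ^ (2 * ℓ) / (p : ℝ)) * (H : ℝ) ^ ε := by
  have hH1 : (1 : ℝ) ≤ H := by exact_mod_cast hH
  have hH0 : (0 : ℝ) < H := by linarith
  have hp0 : (0 : ℝ) < p := by exact_mod_cast (Fact.out : p.Prime).pos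
  have hℓ1 : (1 : ℝ) ≤ ℓ := by exact_mod_cast hℓ
  set x : ℝ := (H : ℝ) ^ (2 / ((ℓ : ℝ) + 1)) with hx
  have hx1 : 1 ≤ x := Real.one_le_rpow hH1 (by positivity)
  have hxH : x ≤ H := by
    calc x ≤ (H : ℝ) ^ (1 : ℝ) := by
          apply Real.rpow_le_rpow_of_exponent_le hH1
          rw [div_le_one (by positivity)]; linarith
      _ = H := Real.rpow_one _
  set M := ⌈x⌉₊ with hMdef
  have hMx : x ≤ M := Nat.le_ceil x
  have hM2 : (M : ℝ) ≤ 2 * x := by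
    have := Nat.ceil_lt_add_one (by linarith : 0 ≤ x)
    linarith
  have hMH : M ≤ H := Nat.ceil_le.2 hxH
  have hM1 : 1 ≤ M := Nat.one_le_ceil_iff.2 (by linarith)
  set T := H / M with hTdef
  have hT1 : 1 ≤ T := Nat.div_pos hMH hM1
  have hTM : T * M ≤ H := Nat.div_mul_le_self H M
  have hTH : T ≤ H := Nat.div_le_self H M
  have hHlt : H ≤ 2 * T * M := by
    have h1 : H < M * (T + 1) := Nat.lt_mul_div_succ H hM1
    nlinarith
  have hHltR : (H : ℝ) ≤ 2 * T * M := by exact_mod_cast hHlt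
  have hM0 : (0 : ℝ) < M := by exact_mod_cast hM1
  have hT0 : (0 : ℝ) < T := by exact_mod_cast hT1
  refine (core_bound p s ℓ hs hℓ hℓp L H M T hH hL hLp hM1 hT1 hTM).trans ?_
  set E : ℝ := (H : ℝ) ^ ((2 * (ℓ : ℝ) ^ 2) / ((ℓ : ℝ) + 1)) with hE
  have hE0 : 0 < E := Real.rpow_pos_of_pos hH0 _
  have hpow : (H : ℝ) ^ (2 * ℓ) = E * x ^ ℓ := by
    rw [hE, hx, ← Real.rpow_natCast (H : ℝ), ← Real.rpow_natCast _ ℓ, ← Real.rpow_mul hH0.le,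
      ← Real.rpow_add hH0]
    congr 1
    push_cast
    field_simp
  have hx2 : x ^ ℓ * x = (H : ℝ) ^ 2 := by
    rw [← pow_succ, hx, ← Real.rpow_natCast, ← Real.rpow_natCast, ← Real.rpow_mul hH0.le]
    congr 1
    push_cast
    field_simp
  have hx0 : 0 < x := by linarith
  have hz1 : 3 / (M : ℝ) ^ ℓ ≤ 3 / x ^ ℓ := by gcongr
  have hz2 : 1 / ((H : ℝ) * T) ≤ 4 / x ^ ℓ := by
    rw [div_le_div_iff₀ (by positivity) (by positivity), one_mul]
    refine le_of_mul_le_mul_right ?_ hx0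
    rw [hx2]
    have : (H : ℝ) ≤ 4 * T * x := by nlinarith
    nlinarith
  have hsb := hsum_bound T H hT1 hTH ε hε
  have hfin : (H : ℝ) ^ (2 * ℓ) * (1 / p + 1 / (H * T) + 3 / (M : ℝ) ^ ℓ) ≤
      7 * (E + (H : ℝ) ^ (2 * ℓ) / (p : ℝ)) := by
    calc _ ≤ (H : ℝ) ^ (2 * ℓ) * (1 / p + 4 / x ^ ℓ + 3 / x ^ ℓ) := by gcongr
      _ = (H : ℝ) ^ (2 * ℓ) / p + 7 * ((H : ℝ) ^ (2 * ℓ) / x ^ ℓ) := by ring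
      _ = (H : ℝ) ^ (2 * ℓ) / p + 7 * E := by
          congr 2
          rw [hpow]; field_simp
      _ ≤ _ := by
          have : 0 ≤ (H : ℝ) ^ (2 * ℓ) / p := by positivity
          linarith
  calc _ = 3 * 4 ^ ℓ * (2 * ℓ * s + ℓ ^ ℓ) * hsum T ^ 2 *
        ((H : ℝ) ^ (2 * ℓ) * (1 / p + 1 / (H * T) + 3 / (M : ℝ) ^ ℓ)) := by ring
    _ ≤ 3 * 4 ^ ℓ * (2 * ℓ * s + ℓ ^ ℓ) * ((1 + 2 / ε) ^ 2 * (H : ℝ) ^ ε) *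
        (7 * (E + (H : ℝ) ^ (2 * ℓ) / (p : ℝ))) := by gcongr
    _ = _ := by ring

/-- Lemma 2.6 (Bourgain–Garaev): bound for the number of solutions of
x₁^{-s} + ⋯ + x_ℓ^{-s} ≡ x_{ℓ+1}^{-s} + ⋯ + x_{2ℓ}^{-s} (mod p) with all
variables in the interval 𝓧 = {L+1,…,L+H}. -/
theorem stmt_9 (s ℓ : ℕ) (hs : 0 < s) (hℓ : 0 < ℓ) :
    ∀ ε : ℝ, 0 < ε → ∃ C : ℝ, 0 < C ∧
      ∀ (p : ℕ), p.Prime → ∀ (L H : ℤ), 2 ≤ H →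
      (∀ x ∈ Finset.Icc (L + 1) (L + H), 1 ≤ x ∧ x ≤ (p : ℤ) - 1) →
      ((((Fintype.piFinset (fun _ : Fin ℓ => Finset.Icc (L + 1) (L + H))) ×ˢ
          (Fintype.piFinset (fun _ : Fin ℓ => Finset.Icc (L + 1) (L + H)))).filter
          (fun q => ∑ i, ((((q.1 i : ZMod p)) ^ s)⁻¹)
                  = ∑ i, ((((q.2 i : ZMod p)) ^ s)⁻¹))).card : ℝ) ≤
        C * ((H : ℝ) ^ ((2 * (ℓ : ℝ) ^ 2) / ((ℓ : ℝ) + 1)) + (H : ℝ) ^ (2 * ℓ) / (p : ℝ))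
          * (H : ℝ) ^ ε := by
  intro ε hε
  set C0 : ℝ := 21 * 4 ^ ℓ * (2 * ℓ * s + ℓ ^ ℓ) * (1 + 2 / ε) ^ 2 with hC0
  have hC0n : 0 ≤ C0 := by positivity
  have hℓR : (0 : ℝ) < ℓ := by exact_mod_cast hℓ
  refine ⟨C0 + ℓ, by positivity, ?_⟩
  intro p hp L H hH hX
  have : Fact p.Prime := ⟨hp⟩
  obtain ⟨n, rfl⟩ := Int.eq_ofNat_of_zero_le (by omega : 0 ≤ H)
  have hL : 0 ≤ L := by
    have := (hX (L + 1) (mem_Icc.2 ⟨le_refl _, by omega⟩)).1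
    omega
  have hLp : L + n ≤ (p : ℤ) - 1 := (hX (L + n) (mem_Icc.2 ⟨by omega, le_refl _⟩)).2
  have hn1 : 1 ≤ n := by omega
  have hnR : (1 : ℝ) ≤ n := by exact_mod_cast hn1
  have hp0 : (0 : ℝ) < p := by exact_mod_cast hp.pos
  rw [Int.cast_natCast]
  set R : ℝ := (n : ℝ) ^ ((2 * (ℓ : ℝ) ^ 2) / ((ℓ : ℝ) + 1)) + (n : ℝ) ^ (2 * ℓ) / (p : ℝ) with hR
  have hR0 : 0 ≤ R := by positivity
  have hne : (1 : ℝ) ≤ (n : ℝ) ^ ε := Real.one_le_rpow hnR hε.le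
  change (solCount p (Icc (L + 1) (L + n)) (fun x : ℤ => ((x : ZMod p) ^ s)⁻¹) ℓ : ℝ) ≤ _
  by_cases hℓp : ℓ < p
  · refine (param_bound p s ℓ hs hℓ hℓp L n hn1 hL hLp ε hε).trans ?_
    rw [← hC0, ← hR]
    gcongr
    linarith
  · have h1 : solCount p (Icc (L + 1) (L + n)) (fun x : ℤ => ((x : ZMod p) ^ s)⁻¹) ℓ ≤ n ^ (2 * ℓ) := by
      refine (card_le_card (filter_subset _ _)).trans (le_of_eq ?_)
      rw [card_product, Fintype.card_piFinset_const, Int.card_Icc, two_mul, pow_add]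
      congr 2 <;> omega
    have h1R : (solCount p (Icc (L + 1) (L + n)) (fun x : ℤ => ((x : ZMod p) ^ s)⁻¹) ℓ : ℝ) ≤
        (n : ℝ) ^ (2 * ℓ) := by exact_mod_cast h1
    have hpl : (p : ℝ) ≤ ℓ := by exact_mod_cast not_lt.1 hℓp
    calc _ ≤ (n : ℝ) ^ (2 * ℓ) := h1R
      _ = p * ((n : ℝ) ^ (2 * ℓ) / p) := by field_simp
      _ ≤ (C0 + ℓ) * R := by
          have : 0 ≤ (n : ℝ) ^ ((2 * (ℓ : ℝ) ^ 2) / ((ℓ : ℝ) + 1)) := by positivity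
          have h2 : (n : ℝ) ^ (2 * ℓ) / p ≤ R := by rw [hR]; linarith
          gcongr
          linarith
      _ ≤ (C0 + ℓ) * R * (n : ℝ) ^ ε := le_mul_of_one_le_right (by positivity) hne
end
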